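/- arXiv:1809.10761 — 2 statements merged into one kernel-verified Lean document; each statement's English description precedes it below -/
import Mathlib

section
/- Every d-regular graph with d ≥ 2 admits an edge weighting with weights in {1,2,3,4} such that for every edge uv, the sum of the weights of edges incident to u differs from the sum of the weights of edges incident to v. -/
open scoped Classical

theorem exists_subset_card_add_notMem {V : Type*} (N : Finset V) (c : V → ℤ) (b : ℤ) :
    ∃ T ⊆ N, ∀ w ∈ N, b + T.card ≠ c w := by
  have hcard : (N.image c).card < ((Finset.range (N.card + 1)).image fun t : ℕ => b + t).card := by
    rw [Finset.card_image_of_injective (Finset.range _) fun s t h => by simpa using h,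
      Finset.card_range]
    exact Nat.lt_succ_of_le Finset.card_image_le
  obtain ⟨s, hs, hsc⟩ := Finset.exists_mem_notMem_of_card_lt_card hcard
  obtain ⟨t, ht, rfl⟩ := Finset.mem_image.1 hs
  obtain ⟨T, hT, rfl⟩ := Finset.exists_subset_card_eq (Nat.lt_succ_iff.1 (Finset.mem_range.1 ht))
  exact ⟨T, hT, fun w hw h => hsc (Finset.mem_image.2 ⟨w, hw, h.symm⟩)⟩

/-- The vertices of `P` are treated one at a time. The value `c x` of a treated vertex never changes:
adjustments of edges at `x` are compensated by `own x`. -/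
theorem exists_greedy_weighting {V : Type*} [Fintype V] (Γ : SimpleGraph V) (P : Finset V) :
    ∃ (Y : V → V → ℤ) (own c : V → ℤ),
      (∀ x, c x = own x + ∑ y ∈ Γ.neighborFinset x, Y x y) ∧
      (∀ x y, Y x y = Y y x) ∧ (∀ x y, -2 ≤ Y x y ∧ Y x y ≤ 0) ∧
      (∀ x y, x ∉ P → Y x y = -1) ∧ (∀ x, own x = 0 ∨ own x = 1) ∧ (∀ x ∉ P, own x = 0) ∧
      (∀ x ∈ P, ∀ y ∈ P, Γ.Adj x y → c x ≠ c y) ∧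
      (∀ x ∈ P, ∀ y, Γ.Adj x y → c x ≤ -1) ∧
      (∀ x ∈ P, c x + own x ≤ -((Γ.neighborFinset x \ P).card : ℤ)) := by
  induction P using Finset.induction_on with
  | empty =>
    exact ⟨fun _ _ => -1, fun _ => 0, _, fun x => rfl, by simp⟩
  | insert z P hz ih =>
    obtain ⟨Y, own, c, hc, hsymm, hrange, hout, hown, hown0, hproper, hneg, hbound⟩ := ih
    set N := Γ.neighborFinset z ∩ P with hN
    set M := Γ.neighborFinset z \ P with hM
    have hNP : ∀ x ∈ N, x ∈ P ∧ Γ.Adj z x := by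
      intro x hx
      simp only [hN, Finset.mem_inter, SimpleGraph.mem_neighborFinset] at hx
      exact ⟨hx.2, hx.1⟩
    have hzN : z ∉ N := fun h => hz (hNP z h).1
    have hout_pos : ∀ x ∈ N, (1 : ℤ) ≤ ((Γ.neighborFinset x \ P).card : ℤ) := by
      intro x hx
      have : 0 < (Γ.neighborFinset x \ P).card :=
        Finset.card_pos.2 ⟨z, by simp [hz, (hNP x hx).2.symm]⟩
      exact_mod_cast this
    have hsum_le : ∑ y ∈ N, own y ≤ N.card := by
      have := Finset.sum_le_card_nsmul N own 1 fun y _ => by rcases hown y with h | h <;> simp [h]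
      simpa using this
    obtain ⟨T, hTN, hTc, hTneg⟩ : ∃ T ⊆ N,
        (∀ w ∈ N, (-(M.card : ℤ) - 2 * N.card + ∑ y ∈ N, own y) + T.card ≠ c w) ∧
        (N.Nonempty ∨ M.Nonempty →
          (-(M.card : ℤ) - 2 * N.card + ∑ y ∈ N, own y) + T.card ≤ -1) := by
      by_cases hfull : M.card = 0 ∧ ∑ y ∈ N, own y = N.card ∧ N.Nonempty
      · obtain ⟨hM0, hNfull, hNne⟩ := hfull
        have hone : ∀ w ∈ N, own w = 1 := by
          have h := (Finset.sum_eq_sum_iff_of_le (s := N) (f := own) (g := fun _ => 1)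
            fun y _ => by rcases hown y with h | h <;> simp [h]).1 (by simpa using hNfull)
          exact h
        have hpos := hNne.card_pos
        obtain ⟨T, hT, hTcard⟩ := Finset.exists_subset_card_eq (Nat.sub_le N.card 1)
        have hval : (-(M.card : ℤ) - 2 * N.card + ∑ y ∈ N, own y) + T.card = -1 := by
          rw [hNfull, hTcard, hM0]; push_cast [hpos]; omega
        refine ⟨T, hT, fun w hw => ?_, fun _ => hval.le⟩
        have h1 := hbound w (hNP w hw).1
        have h2 := hout_pos w hw
        have h3 := hone w hw
        omega
      · obtain ⟨T, hT, hTc⟩ := exists_subset_card_add_notMem N c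
          (-(M.card : ℤ) - 2 * N.card + ∑ y ∈ N, own y)
        refine ⟨T, hT, hTc, fun hne => ?_⟩
        have hle := Finset.card_le_card hT
        by_cases hM0 : M.card = 0
        · have hNne : N.Nonempty := hne.resolve_right fun h => h.card_pos.ne' hM0
          have : ∑ y ∈ N, own y ≠ N.card := fun h => hfull ⟨hM0, h, hNne⟩
          omega
        · omega
    let a : V → ℤ := fun y => -1 + own y + if y ∈ T then 1 else 0
    have ha : ∀ y, a y = -1 + own y + if y ∈ T then 1 else 0 := fun _ => rfl
    let Y' : V → V → ℤ := fun x y => Y x y + (if x = z ∧ y ∈ N then a y else 0) +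
      (if y = z ∧ x ∈ N then a x else 0)
    let own' : V → ℤ := fun x => own x - if x ∈ N then a x else 0
    have hc'P : ∀ x, x ≠ z → own' x + ∑ y ∈ Γ.neighborFinset x, Y' x y = c x := by
      intro x hx
      have hδ : ∑ y ∈ Γ.neighborFinset x, (if y = z ∧ x ∈ N then a x else 0) =
          if x ∈ N then a x else 0 := by
        by_cases hxN : x ∈ N
        · simp [hxN, (hNP x hxN).2.symm]
        · simp [hxN]
      simp only [own', Y', Finset.sum_add_distrib, hδ, hx, false_and, if_false, hc]
      simp
    have hc'z : own' z + ∑ y ∈ Γ.neighborFinset z, Y' z y =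
        (-(M.card : ℤ) - 2 * N.card + ∑ y ∈ N, own y) + T.card := by
      have h1 : ∑ y ∈ Γ.neighborFinset z, Y z y = -(M.card : ℤ) - N.card := by
        rw [Finset.sum_congr rfl fun y _ => hout z y hz]
        have := Finset.card_sdiff_add_card_inter (Γ.neighborFinset z) P
        rw [← hN, ← hM] at this
        simp only [Finset.sum_const, nsmul_eq_mul]
        rw [← this]; push_cast; ring
      have h2 : ∑ y ∈ Γ.neighborFinset z, (if y ∈ N then a y else 0) = ∑ y ∈ N, a y := by
        rw [← Finset.sum_filter]
        congr 1
        ext y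
        simp only [Finset.mem_filter, SimpleGraph.mem_neighborFinset]
        exact ⟨fun h => h.2, fun h => ⟨(hNP y h).2, h⟩⟩
      have h3 : ∑ y ∈ N, a y = -(N.card : ℤ) + ∑ y ∈ N, own y + T.card := by
        simp only [ha, Finset.sum_add_distrib]
        rw [← Finset.sum_filter, Finset.filter_mem_eq_inter, Finset.inter_eq_right.2 hTN]
        simp
      simp only [own', Y', Finset.sum_add_distrib, hzN, if_false, true_and, and_false, h1, h2, h3,
        hown0 z hz]
      simp
      ring
    have hne : ∀ x ∈ P, x ≠ z := fun x hx h => hz (h ▸ hx)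
    refine ⟨Y', own', fun x => own' x + ∑ y ∈ Γ.neighborFinset x, Y' x y, fun _ => rfl,
      ?_, ?_, ?_, ?_, ?_, ?_, ?_, ?_⟩
    · intro x y
      simp only [Y', hsymm x y]
      ring
    · intro x y
      have harange : ∀ y, -1 ≤ a y ∧ a y ≤ 1 := by
        intro y
        rw [ha]
        rcases hown y with h | h <;> split_ifs <;> omega
      have hx := harange x
      have hy := harange y
      have hr := hrange x y
      simp only [Y']
      split_ifs with h1 h2 h2
      · exact absurd (h1.1 ▸ h2.2) hzN
      · rw [h1.1, hout z y hz]; omega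
      · rw [h2.1, hsymm, hout z x hz]; omega
      · omega
    · intro x y hx
      rw [Finset.mem_insert, not_or] at hx
      have : x ∉ N := fun h => hx.2 (hNP x h).1
      simp [Y', hx.1, this, hout x y hx.2]
    · intro x
      simp only [own', ha]
      rcases hown x with h | h <;> split_ifs <;> omega
    · intro x hx
      rw [Finset.mem_insert, not_or] at hx
      have : x ∉ N := fun h => hx.2 (hNP x h).1
      simp [own', this, hown0 x hx.2]
    · have hadj : ∀ x ∈ P, Γ.Adj z x → x ∈ N := fun x hx h => by simp [hN, hx, h]
      intro x hx y hy hxy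
      rw [Finset.mem_insert] at hx hy
      rcases hx with rfl | hx <;> rcases hy with rfl | hy
      · exact absurd hxy (Γ.irrefl)
      · simp only [hc'z, hc'P y (hne y hy)]
        exact hTc y (hadj y hy hxy)
      · simp only [hc'z, hc'P x (hne x hx)]
        exact (hTc x (hadj x hx hxy.symm)).symm
      · simp only [hc'P y (hne y hy), hc'P x (hne x hx)]
        exact hproper x hx y hy hxy
    · intro x hx y hxy
      rcases Finset.mem_insert.1 hx with rfl | hx
      · simp only [hc'z]
        refine hTneg ?_
        by_cases hy : y ∈ P
        · exact Or.inl ⟨y, by simp [hN, hy, hxy]⟩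
        · exact Or.inr ⟨y, by simp [hM, hy, hxy]⟩
      · simp only [hc'P x (hne x hx)]
        exact hneg x hx y hxy
    · intro x hx
      have hsub : (Γ.neighborFinset x \ insert z P).card ≤ (Γ.neighborFinset x \ P).card :=
        Finset.card_le_card (Finset.sdiff_subset_sdiff le_rfl (Finset.subset_insert _ _))
      rcases Finset.mem_insert.1 hx with rfl | hx
      · have hle := Finset.card_le_card hTN
        have hown'x : own' x = 0 := by simp [own', hzN, hown0 x hz]
        simp only [hown'x]
        rw [← hM] at hsub
        omega
      · simp only [hc'P x (hne x hx)]
        have hb := hbound x hx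
        by_cases hxN : x ∈ N
        · have hlt : (Γ.neighborFinset x \ insert z P).card < (Γ.neighborFinset x \ P).card := by
            refine Finset.card_lt_card ⟨Finset.sdiff_subset_sdiff le_rfl
              (Finset.subset_insert _ _), fun h => ?_⟩
            have : z ∈ Γ.neighborFinset x \ P := by simp [hz, (hNP x hxN).2.symm]
            simpa using h this
          simp only [own', hxN, if_true, ha]
          rcases hown x with h | h <;> split_ifs <;> omega
        · simp only [own', hxN, if_false]
          omega

theorem exists_parent_parity {V : Type*} (p : V → V) (δ : V → ℕ) (A : Finset V)
    (hp : ∀ x ∈ A, δ (p x) < δ x) (t : V → ℤ) :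
    ∃ j : V → ℤ, (∀ x, j x = 0 ∨ j x = 1) ∧ (∀ x ∉ A, j x = 0) ∧
      ∀ x ∈ A, Even (j x + ∑ y ∈ A with p y = x, j y - t x) := by
  induction A using Finset.induction_on_max_value δ generalizing t with
  | empty => exact ⟨fun _ => 0, by simp⟩
  | insert a s ha hmax ih =>
    obtain ⟨j, hj, hj0, hpar⟩ := ih (fun x hx => hp x (Finset.mem_insert_of_mem hx))
      (fun x => t x - if p a = x then t a % 2 else 0)
    have hpa := hp a (Finset.mem_insert_self _ _)
    have hne : ∀ y ∈ insert a s, p y ≠ a := by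
      intro y hy h
      have h1 := hp y hy
      rw [h] at h1
      rcases Finset.mem_insert.1 hy with rfl | hy
      · exact lt_irrefl _ h1
      · exact absurd (hmax y hy) (not_le.2 h1)
    have hsum : ∀ (B : Finset V), B ⊆ s → ∑ y ∈ B, Function.update j a (t a % 2) y =
        ∑ y ∈ B, j y := fun B hB => Finset.sum_congr rfl fun y hy =>
      Function.update_of_ne (ne_of_mem_of_not_mem (hB hy) ha) _ _
    refine ⟨Function.update j a (t a % 2), fun x => ?_, fun x hx => ?_, fun x hx => ?_⟩
    · rcases eq_or_ne x a with rfl | h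
      · simpa using Int.emod_two_eq_zero_or_one _
      · simpa [h] using hj x
    · rw [Finset.mem_insert, not_or] at hx
      simpa [hx.1] using hj0 x hx.2
    · rcases eq_or_ne x a with rfl | h
      · rw [Finset.filter_false_of_mem hne]
        simp only [Function.update_self, Finset.sum_empty]
        rw [Int.even_iff]; omega
      · have hxs := Finset.mem_of_mem_insert_of_ne hx h
        have := hpar x hxs
        rw [Finset.filter_insert]
        by_cases hpx : p a = x
        · rw [if_pos hpx, Finset.sum_insert (by simp [ha]), hsum _ (Finset.filter_subset _ _)]
          simp only [Function.update_self, Function.update_of_ne h]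
          rw [if_pos hpx] at this
          rw [Int.even_iff] at this ⊢
          omega
        · rw [if_neg hpx, hsum _ (Finset.filter_subset _ _), Function.update_of_ne h]
          simpa [hpx] using this

theorem exists_signs_sum_eq {V : Type*} (C : Finset V) (j : V → ℤ)
    (hj : ∀ x, j x = 0 ∨ j x = 1) (m : ℤ) (hm : -1 ≤ m ∧ m ≤ 1)
    (hpar : Even (∑ y ∈ C, j y - m)) :
    ∃ s : V → ℤ, (∀ y, s y = j y ∨ s y = -j y) ∧ ∑ y ∈ C, s y = m := by
  obtain ⟨s, hs, hsum, hspar⟩ : ∃ s : V → ℤ, (∀ y, s y = j y ∨ s y = -j y) ∧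
      (∑ y ∈ C, s y = 0 ∨ ∑ y ∈ C, s y = 1) ∧ Even (∑ y ∈ C, j y - ∑ y ∈ C, s y) := by
    clear hpar
    induction C using Finset.induction_on with
    | empty => exact ⟨j, by simp⟩
    | insert a C ha ih =>
      obtain ⟨s, hs, hsum, hspar⟩ := ih
      have hupd : ∀ r, ∑ y ∈ insert a C, Function.update s a r y = r + ∑ y ∈ C, s y := by
        intro r
        rw [Finset.sum_insert ha, Function.update_self]
        congr 1
        exact Finset.sum_congr rfl fun y hy => Function.update_of_ne (ne_of_mem_of_not_mem hy ha) _ _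
      have hmem : ∀ r, (r = j a ∨ r = -j a) →
          ∀ y, Function.update s a r y = j y ∨ Function.update s a r y = -j y := by
        intro r hr y
        rcases eq_or_ne y a with rfl | h
        · simpa using hr
        · simpa [h] using hs y
      rw [Finset.sum_insert ha]
      rcases hsum with h | h
      · refine ⟨Function.update s a (j a), hmem _ (Or.inl rfl), ?_, ?_⟩
        · rw [hupd, h]; simpa using hj a
        · rw [hupd]; simpa using hspar
      · refine ⟨Function.update s a (-j a), hmem _ (Or.inr rfl), ?_, ?_⟩
        · rw [hupd, h]; rcases hj a with h | h <;> simp [h]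
        · rw [hupd]
          rw [Int.even_iff] at hspar ⊢
          omega
  rw [Int.even_iff] at hpar hspar
  by_cases h : ∑ y ∈ C, s y = m
  · exact ⟨s, hs, h⟩
  · refine ⟨fun y => -s y, fun y => ?_, ?_⟩
    · rcases hs y with h | h <;> simp [h]
    · rw [Finset.sum_neg_distrib]; omega

theorem exists_parent {V : Type*} (B : SimpleGraph V) (v : V) :
    ∃ p : V → V, ∀ x, B.Reachable v x → x ≠ v →
      B.Adj x (p x) ∧ B.dist v (p x) < B.dist v x := by
  have : ∀ x, ∃ y, B.Reachable v x → x ≠ v → B.Adj x y ∧ B.dist v y < B.dist v x := by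
    intro x
    by_cases h : B.Reachable v x ∧ x ≠ v
    · obtain ⟨q, hq⟩ := h.1.symm.exists_walk_length_eq_dist
      cases q with
      | nil => exact absurd rfl h.2
      | cons hadj q =>
        refine ⟨_, fun _ _ => ⟨hadj, ?_⟩⟩
        rw [B.dist_comm, B.dist_comm (u := v), ← hq]
        exact Nat.lt_succ_of_le (SimpleGraph.dist_le q)
    · exact ⟨x, fun h1 h2 => absurd ⟨h1, h2⟩ h⟩
  choose p hp using this
  exact ⟨p, hp⟩

theorem exists_weighting_of_common_neighbor {V : Type*} [Fintype V] (B : SimpleGraph V)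
    (I Z : Set V) (hbip : ∀ x y, B.Adj x y → (x ∈ I ↔ y ∉ I)) (hZI : ∀ x ∈ Z, x ∉ I)
    (own : V → ℤ) (hown : ∀ x, own x = 0 ∨ own x = 1) {v v' u : V} (hv : v ∈ Z) (hv' : v' ∈ Z)
    (hne : v' ≠ v) (hvu : B.Adj v u) (hv'u : B.Adj v' u) :
    ∃ F : V → V → ℤ, (∀ x y, F x y = F y x) ∧ (∀ x y, -2 ≤ F x y ∧ F x y ≤ 1) ∧
      (∀ x y, F x y ≠ 0 → B.Adj x y) ∧
      ∀ x, B.Reachable v x →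
        (x ∉ I → x ∉ Z → ∑ y, F x y = own x) ∧
        (x ∈ I → 0 ≤ ∑ y, F x y ∧ Even (∑ y, F x y)) ∧
        (x ∈ Z → ∑ y, F x y < 0 ∨ Odd (∑ y, F x y)) := by
  have huI : u ∈ I := by
    by_contra h
    exact hZI v hv ((hbip v u hvu).2 h)
  have huv : u ≠ v := fun h => hZI v hv (h ▸ huI)
  have huv' : u ≠ v' := fun h => hZI v' hv' (h ▸ huI)
  have hru : B.Reachable v u := hvu.reachable
  have hrv' : B.Reachable v v' := hru.trans hv'u.symm.reachable
  have hdu : B.dist v u = 1 := SimpleGraph.dist_eq_one_iff_adj.2 hvu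
  have hdv' : B.dist v u < B.dist v v' := by
    rw [hdu]
    refine hrv'.one_lt_dist_of_ne_of_not_adj hne.symm fun h => ?_
    exact hZI v hv ((hbip v v' h).2 (hZI v' hv'))
  obtain ⟨p, hp, hpv'⟩ : ∃ p : V → V, (∀ x, B.Reachable v x → x ≠ v →
      B.Adj x (p x) ∧ B.dist v (p x) < B.dist v x) ∧ p v' = u := by
    obtain ⟨p, hp⟩ := exists_parent B v
    refine ⟨Function.update p v' u, fun x hx hxv => ?_, by simp⟩
    rcases eq_or_ne x v' with rfl | h
    · simpa using ⟨hv'u, hdv'⟩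
    · simpa [h] using hp x hx hxv
  have hpu : p u = v := by
    have h1 := (hp u hru huv)
    have h2 : B.Reachable v (p u) := hru.trans h1.1.reachable
    rw [hdu, Nat.lt_one_iff] at h1
    exact (h2.dist_eq_zero_iff.1 h1.2).symm
  set A : Finset V := {x | B.Reachable v x ∧ x ≠ v} with hA
  have hmemA : ∀ x, x ∈ A ↔ B.Reachable v x ∧ x ≠ v := by simp [hA]
  have hpA : ∀ x ∈ A, B.Adj x (p x) ∧ B.dist v (p x) < B.dist v x := fun x hx =>
    hp x ((hmemA x).1 hx).1 ((hmemA x).1 hx).2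
  obtain ⟨j, hj, hj0, hpar⟩ := exists_parent_parity p (B.dist v) A (fun x hx => (hpA x hx).2)
    (fun x => if x ∈ I then 0 else if x ∈ Z then 1 else own x)
  have hs : ∀ w, ∃ s : V → ℤ, (∀ y, s y = j y ∨ s y = -j y) ∧
      (w ∈ A → w ∉ I → w ∉ Z → ∑ y ∈ A with p y = w, s y = own w - j w) ∧
      (w ∈ Z → ∀ y, s y = -j y) := by
    intro w
    by_cases hw : w ∈ A ∧ w ∉ I ∧ w ∉ Z
    · obtain ⟨s, hs, hsum⟩ := exists_signs_sum_eq {y ∈ A | p y = w} j hj (own w - j w)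
        (by rcases hown w with h | h <;> rcases hj w with h' | h' <;> omega) (by
          have := hpar w hw.1
          rw [if_neg hw.2.1, if_neg hw.2.2] at this
          rw [Int.even_iff] at this ⊢
          omega)
      exact ⟨s, hs, fun _ _ _ => hsum, fun h => absurd h hw.2.2⟩
    · exact ⟨fun y => -j y, fun y => Or.inr rfl, fun h1 h2 h3 => absurd ⟨h1, h2, h3⟩ hw,
        fun _ _ => rfl⟩
  choose s hs hsw hsZ using hs
  let val : V → ℤ := fun x => if x ∈ I then s (p x) x else j x
  have hval : ∀ x, val x = j x ∨ val x = -j x := by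
    intro x
    by_cases h : x ∈ I
    · simpa [val, h] using hs (p x) x
    · simp [val, h]
  have hval0 : ∀ x ∉ A, val x = 0 := by
    intro x hx
    have := hj0 x hx
    rcases hval x with h | h <;> omega
  let F₀ : V → V → ℤ := fun x y => (if p y = x then val y else 0) + if p x = y then val x else 0
  have hF₀sum : ∀ x, ∑ y, F₀ x y = ∑ y ∈ A with p y = x, val y + val x := by
    intro x
    simp only [F₀, Finset.sum_add_distrib, Finset.sum_ite_eq, Finset.mem_univ, if_true]
    rw [← Finset.sum_filter]
    congr 1
    refine (Finset.sum_subset (Finset.filter_subset_filter _ (Finset.subset_univ _)) ?_).symm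
    intro y hy hyA
    simp only [Finset.mem_filter, Finset.mem_univ, true_and, not_and] at hy hyA
    exact hval0 y fun h => hyA h hy
  have hF₀adj : ∀ x y, F₀ x y ≠ 0 → B.Adj x y := by
    intro x y h
    by_contra hxy
    refine h ?_
    have h1 : (if p y = x then val y else 0) = 0 := by
      split_ifs with h
      · exact hval0 y fun hy => hxy (h ▸ (hpA y hy).1.symm)
      · rfl
    have h2 : (if p x = y then val x else 0) = 0 := by
      split_ifs with h
      · exact hval0 x fun hx => hxy (h ▸ (hpA x hx).1)
      · rfl
    simp only [F₀, h1, h2, add_zero]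
  have hF₀range : ∀ x y, -1 ≤ F₀ x y ∧ F₀ x y ≤ 1 := by
    have hr : ∀ x, -1 ≤ val x ∧ val x ≤ 1 := by
      intro x
      rcases hval x with h | h <;> rcases hj x with h' | h' <;> omega
    intro x y
    have hx := hr x
    have hy := hr y
    simp only [F₀]
    split_ifs with h1 h2 h2
    · by_cases hxA : x ∈ A
      · by_cases hyA : y ∈ A
        · have h3 := (hpA x hxA).2
          have h4 := (hpA y hyA).2
          rw [h2] at h3
          rw [h1] at h4
          omega
        · rw [hval0 y hyA]; omega
      · rw [hval0 x hxA]; omega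
    all_goals omega
  have hchild : ∀ x, ∀ y ∈ ({y ∈ A | p y = x} : Finset V), (y ∈ I ↔ x ∉ I) := by
    intro x y hy
    rw [Finset.mem_filter] at hy
    exact hy.2 ▸ hbip y (p y) (hpA y hy.1).1
  have hjsum : ∀ x, 0 ≤ ∑ y ∈ A with p y = x, j y := fun x =>
    Finset.sum_nonneg fun y _ => by rcases hj y with h | h <;> omega
  have hchildI : ∀ x ∈ I, ∑ y ∈ A with p y = x, val y = ∑ y ∈ A with p y = x, j y := by
    intro x hx
    refine Finset.sum_congr rfl fun y hy => ?_
    have : y ∉ I := fun h => (hchild x y hy).1 h hx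
    simp [val, this]
  have hchildZ : ∀ x ∈ Z, ∑ y ∈ A with p y = x, val y = -∑ y ∈ A with p y = x, j y := by
    intro x hx
    rw [← Finset.sum_neg_distrib]
    refine Finset.sum_congr rfl fun y hy => ?_
    have hyI : y ∈ I := (hchild x y hy).2 (hZI x hx)
    rw [Finset.mem_filter] at hy
    simp [val, hyI, hsZ _ (hy.2.symm ▸ hx : p y ∈ Z)]
  have hsumW : ∀ x, B.Reachable v x → x ∉ I → x ∉ Z → ∑ y, F₀ x y = own x := by
    intro x hx hxI hxZ
    have hxA : x ∈ A := (hmemA x).2 ⟨hx, fun h => hxZ (h ▸ hv)⟩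
    have : ∑ y ∈ A with p y = x, val y = ∑ y ∈ A with p y = x, s x y := by
      refine Finset.sum_congr rfl fun y hy => ?_
      have hyI : y ∈ I := (hchild x y hy).2 hxI
      rw [Finset.mem_filter] at hy
      simp [val, hyI, hy.2]
    rw [hF₀sum, this, hsw x hxA hxI hxZ]
    simp [val, hxI]
  have hsumI : ∀ x, B.Reachable v x → x ∈ I → 0 ≤ ∑ y, F₀ x y ∧ Even (∑ y, F₀ x y) := by
    intro x hx hxI
    have hxA : x ∈ A := (hmemA x).2 ⟨hx, fun h => hZI v hv (h ▸ hxI)⟩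
    have h1 := hpar x hxA
    have h2 := hjsum x
    rw [if_pos hxI] at h1
    rw [hF₀sum, hchildI x hxI]
    rw [Int.even_iff] at h1 ⊢
    rcases hval x with h | h <;> rcases hj x with h' | h' <;> omega
  have hsumZ : ∀ x, B.Reachable v x → x ∈ Z → x ≠ v → Odd (∑ y, F₀ x y) := by
    intro x hx hxZ hxv
    have h1 := hpar x ((hmemA x).2 ⟨hx, hxv⟩)
    rw [if_neg (hZI x hxZ), if_pos hxZ] at h1
    rw [hF₀sum, hchildZ x hxZ]
    rw [Int.even_iff] at h1
    rw [Int.odd_iff]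
    rcases hval x with h | h <;> omega
  have hsumv : ∑ y, F₀ v y = -∑ y ∈ A with p y = v, j y := by
    rw [hF₀sum, hchildZ v hv, hval0 v fun h => ((hmemA v).1 h).2 rfl, add_zero]
  have key : ∀ α β : ℤ, (α = 0 ∨ F₀ v u = 0 ∧ -2 ≤ α ∧ α ≤ 1) →
      (β = 0 ∨ F₀ v' u = 0 ∧ -2 ≤ β ∧ β ≤ 1) → 0 ≤ ∑ y, F₀ u y + α + β → Even (α + β) →
      (∑ y, F₀ v y + α < 0 ∨ Odd (∑ y, F₀ v y + α)) →
      (∑ y, F₀ v' y + β < 0 ∨ Odd (∑ y, F₀ v' y + β)) →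
      ∃ F : V → V → ℤ, (∀ x y, F x y = F y x) ∧ (∀ x y, -2 ≤ F x y ∧ F x y ≤ 1) ∧
      (∀ x y, F x y ≠ 0 → B.Adj x y) ∧
      ∀ x, B.Reachable v x →
        (x ∉ I → x ∉ Z → ∑ y, F x y = own x) ∧
        (x ∈ I → 0 ≤ ∑ y, F x y ∧ Even (∑ y, F x y)) ∧
        (x ∈ Z → ∑ y, F x y < 0 ∨ Odd (∑ y, F x y)) := by
    intro α β hα hβ hu hαβ hodd hodd'
    let F : V → V → ℤ := fun x y => F₀ x y +
      ((if x = v then if y = u then α else 0 else 0) + if x = u then if y = v then α else 0 else 0) +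
      ((if x = v' then if y = u then β else 0 else 0) +
        if x = u then if y = v' then β else 0 else 0)
    have hsymm₀ : ∀ x y, F₀ x y = F₀ y x := fun x y => add_comm _ _
    have hsymm : ∀ x y, F x y = F y x := by
      intro x y
      simp only [F, hsymm₀ x y]
      split_ifs <;> simp
    have hFsum : ∀ x, ∑ y, F x y = ∑ y, F₀ x y + ((if x = v then α else 0) +
        if x = u then α else 0) + ((if x = v' then β else 0) + if x = u then β else 0) := by
      intro x
      simp only [F, Finset.sum_add_distrib]
      congr 2 <;> congr 1 <;> split_ifs <;> simp
    have hFvu : F v u = F₀ v u + α := by simp [F, huv.symm, hne.symm]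
    have hFv'u : F v' u = F₀ v' u + β := by simp [F, huv'.symm, hne]
    have hcase : ∀ x y, x = v ∧ y = u ∨ x = u ∧ y = v ∨ x = v' ∧ y = u ∨ x = u ∧ y = v' ∨
        F x y = F₀ x y := by
      intro x y
      simp only [F]
      grind
    have hrvu := hF₀range v u
    have hrv'u := hF₀range v' u
    refine ⟨F, hsymm, fun x y => ?_, fun x y => ?_, ?_⟩
    · have hrxy := hF₀range x y
      rcases hcase x y with ⟨rfl, rfl⟩ | ⟨rfl, rfl⟩ | ⟨rfl, rfl⟩ | ⟨rfl, rfl⟩ | h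
      · omega
      · rw [hsymm]; omega
      · omega
      · rw [hsymm]; omega
      · omega
    · rcases hcase x y with ⟨rfl, rfl⟩ | ⟨rfl, rfl⟩ | ⟨rfl, rfl⟩ | ⟨rfl, rfl⟩ | h
      · exact fun _ => hvu
      · exact fun _ => hvu.symm
      · exact fun _ => hv'u
      · exact fun _ => hv'u.symm
      · exact h ▸ hF₀adj x y
    · intro x hx
      rw [hFsum]
      refine ⟨fun hxI hxZ => ?_, fun hxI => ?_, fun hxZ => ?_⟩
      · have h1 : x ≠ v := fun h => hxZ (h ▸ hv)
        have h2 : x ≠ v' := fun h => hxZ (h ▸ hv')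
        have h3 : x ≠ u := fun h => hxI (h ▸ huI)
        simp [h1, h2, h3, hsumW x hx hxI hxZ]
      · have h1 : x ≠ v := fun h => hZI v hv (h ▸ hxI)
        have h2 : x ≠ v' := fun h => hZI v' hv' (h ▸ hxI)
        have h := hsumI x hx hxI
        rcases eq_or_ne x u with rfl | h3
        · simp only [h1, h2, if_false, if_true, zero_add]
          rw [Int.even_iff] at *
          omega
        · simpa [h1, h2, h3] using h
      · have h3 : x ≠ u := fun h => hZI x hxZ (h ▸ huI)
        rcases eq_or_ne x v with rfl | h1
        · simpa [h3, hne.symm] using hodd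
        · rcases eq_or_ne x v' with rfl | h2
          · simpa [h3, h1] using hodd'
          · simpa [h1, h2, h3] using Or.inr (hsumZ x hx hxZ h1)
  by_cases hc : ∑ y ∈ A with p y = v, j y = 0
  · have huA : u ∈ A := (hmemA u).2 ⟨hru, huv⟩
    have hv'A : v' ∈ A := (hmemA v').2 ⟨hrv', hne⟩
    have hzero : ∀ x, ∑ y ∈ A with p y = x, j y = 0 → ∀ y ∈ A, p y = x → j y = 0 := by
      intro x hx y hy hyx
      exact (Finset.sum_eq_zero_iff_of_nonneg fun y _ => by rcases hj y with h | h <;> omega).1 hx y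
        (by simp [hy, hyx])
    have hju : j u = 0 := hzero v hc u huA hpu
    have hvalu : val u = 0 := by rcases hval u with h | h <;> omega
    have hF₀vu : F₀ v u = 0 := by
      simp [F₀, hvalu, hval0 v fun h => ((hmemA v).1 h).2 rfl]
    have hSu : ∑ y, F₀ u y = ∑ y ∈ A with p y = u, j y := by
      rw [hF₀sum, hchildI u huI, hvalu, add_zero]
    by_cases hcu : ∑ y ∈ A with p y = u, j y = 0
    · have hjv' : j v' = 0 := hzero u hcu v' hv'A hpv'
      have hvalv' : val v' = 0 := by rcases hval v' with h | h <;> omega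
      have hF₀v'u : F₀ v' u = 0 := by simp [F₀, hvalu, hvalv']
      refine key 1 (-1) (Or.inr ⟨hF₀vu, by norm_num⟩) (Or.inr ⟨hF₀v'u, by norm_num⟩)
        (by rw [hSu, hcu]; norm_num) (by simp) (Or.inr (by rw [hsumv, hc]; simp)) (Or.inl ?_)
      have := hjsum v'
      rw [hF₀sum, hchildZ v' hv', hvalv']
      omega
    · have h1 := hsumI u hru huI
      rw [hSu] at h1
      refine key (-2) 0 (Or.inr ⟨hF₀vu, by norm_num⟩) (Or.inl rfl) ?_ (by simp)
        (Or.inl (by rw [hsumv, hc]; norm_num)) (Or.inr (by simpa using hsumZ v' hrv' hv' hne))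
      rw [hSu]
      rw [Int.even_iff] at h1
      omega
  · refine key 0 0 (Or.inl rfl) (Or.inl rfl) (by simpa using (hsumI u hru huI).1) (by simp)
      (Or.inl ?_) (Or.inr (by simpa using hsumZ v' hrv' hv' hne))
    have := hjsum v
    rw [hsumv]
    omega

theorem exists_star_weighting {V : Type*} [Fintype V] (B : SimpleGraph V) (v : V)
    (hdeg : 2 ≤ B.degree v) (e : V → ℤ) (he : ∀ u, 0 ≤ e u) :
    ∃ h : V → ℤ, (∀ u, -1 ≤ h u ∧ h u ≤ 1) ∧ (∀ u, h u ≠ 0 → B.Adj v u) ∧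
      (∀ u, 0 ≤ e u + h u) ∧ ∀ u, B.Adj v u → ∑ y, h y ≠ e u + h u := by
  by_cases hpos : ∃ u, B.Adj v u ∧ 1 ≤ e u
  · obtain ⟨r, hr, her⟩ := hpos
    have hnonneg : ∀ u, 0 ≤ e u + if u = r then -1 else 0 := by
      intro u
      have := he u
      split_ifs with h
      · subst h; omega
      · omega
    refine ⟨fun u => if u = r then -1 else 0, fun u => ?_, fun u hu => ?_, hnonneg, fun u _ h => ?_⟩
    · dsimp only
      split_ifs <;> norm_num
    · have : u = r := by simpa using hu
      exact this ▸ hr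
    · have := hnonneg u
      rw [← h] at this
      simp at this
  · push Not at hpos
    refine ⟨fun u => if B.Adj v u then 1 else 0, fun u => ?_, fun u hu => ?_, fun u => ?_,
      fun u hu => ?_⟩
    · dsimp only
      split_ifs <;> norm_num
    · simpa using hu
    · have := he u
      dsimp only
      split_ifs <;> omega
    · have h1 := hpos u hu
      have h2 : ∑ y, (if B.Adj v y then (1 : ℤ) else 0) = B.degree v := by
        rw [Finset.sum_boole, ← SimpleGraph.card_neighborFinset_eq_degree,
          SimpleGraph.neighborFinset_eq_filter]
      rw [h2]
      simp only [hu, if_true]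
      omega

theorem exists_weighting_of_no_common_neighbor {V : Type*} [Fintype V] (B : SimpleGraph V)
    (I Z : Set V) (hbip : ∀ x y, B.Adj x y → (x ∈ I ↔ y ∉ I)) (hZI : ∀ x ∈ Z, x ∉ I)
    (hdom : ∀ x ∉ I, ∃ y, B.Adj x y) (hdeg : ∀ x ∈ Z, 2 ≤ B.degree x)
    (own : V → ℤ) (hown : ∀ x, own x = 0 ∨ own x = 1)
    (huniq : ∀ v ∈ Z, ∀ v' ∈ Z, ∀ u, B.Adj v u → B.Adj v' u → v' = v) :
    ∃ F : V → V → ℤ, (∀ x y, F x y = F y x) ∧ (∀ x y, -2 ≤ F x y ∧ F x y ≤ 1) ∧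
      (∀ x y, F x y ≠ 0 → B.Adj x y) ∧
      (∀ x, x ∉ I → x ∉ Z → ∑ y, F x y = own x) ∧
      (∀ x ∈ I, 0 ≤ ∑ y, F x y) ∧
      ∀ x ∈ Z, ∀ u, B.Adj x u → ∑ y, F x y ≠ ∑ y, F u y := by
  have hq : ∀ x, ∃ y, x ∉ I → B.Adj x y := by
    intro x
    by_cases h : x ∈ I
    · exact ⟨x, fun h' => absurd h h'⟩
    · obtain ⟨y, hy⟩ := hdom x h
      exact ⟨y, fun _ => hy⟩
  choose q hq using hq
  let gW : V → V → ℤ := fun x y => if x ∉ I ∧ x ∉ Z then if y = q x then own x else 0 else 0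
  have hgW : ∀ x y, 0 ≤ gW x y ∧ gW x y ≤ 1 := by
    intro x y
    simp only [gW]
    rcases hown x with h | h <;> split_ifs <;> omega
  let e : V → ℤ := fun u => ∑ x, gW x u
  have he : ∀ u, 0 ≤ e u := fun u => Finset.sum_nonneg fun x _ => (hgW x u).1
  have hh : ∀ v, ∃ h : V → ℤ, (∀ u, -1 ≤ h u ∧ h u ≤ 1) ∧ (∀ u, h u ≠ 0 → v ∈ Z ∧ B.Adj v u) ∧
      (∀ u, 0 ≤ e u + h u) ∧ (v ∈ Z → ∀ u, B.Adj v u → ∑ y, h y ≠ e u + h u) := by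
    intro v
    by_cases hv : v ∈ Z
    · obtain ⟨h, h1, h2, h3, h4⟩ := exists_star_weighting B v (hdeg v hv) e he
      exact ⟨h, h1, fun u hu => ⟨hv, h2 u hu⟩, h3, fun _ => h4⟩
    · exact ⟨fun _ => 0, by simp, by simp, by simpa using he, fun h => absurd h hv⟩
  choose h hrange hsupp hnonneg hne using hh
  let g : V → V → ℤ := fun x y => gW x y + h x y
  have hg : ∀ x y, g x y ≠ 0 → B.Adj x y ∧ x ∉ I := by
    intro x y hxy
    by_cases hx : x ∈ Z
    · have : h x y ≠ 0 := by simpa [g, gW, hx] using hxy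
      exact ⟨(hsupp x y this).2, hZI x hx⟩
    · have hh0 : h x y = 0 := by
        by_contra h0
        exact hx (hsupp x y h0).1
      have : (x ∉ I ∧ y = q x) ∧ own x ≠ 0 := by simpa [g, gW, hx, hh0, and_assoc] using hxy
      exact ⟨this.1.2 ▸ hq x this.1.1, this.1.1⟩
  have hgrange : ∀ x y, -1 ≤ g x y ∧ g x y ≤ 1 := by
    intro x y
    have h1 := hgW x y
    have h2 := hrange x y
    by_cases h0 : h x y = 0
    · simp only [g]; omega
    · have hx := (hsupp x y h0).1
      have : gW x y = 0 := by simp [gW, hx]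
      simp only [g]; omega
  have hsumR : ∀ x ∉ I, ∑ y, (g x y + g y x) = ∑ y, g x y := by
    intro x hx
    refine Finset.sum_congr rfl fun y _ => ?_
    have : g y x = 0 := by
      by_contra h0
      have := hg y x h0
      exact this.2 ((hbip y x this.1).2 hx)
    omega
  have hsumI : ∀ u ∈ I, ∑ y, (g u y + g y u) = e u + ∑ y, h y u := by
    intro u hu
    rw [← Finset.sum_add_distrib]
    refine Finset.sum_congr rfl fun y _ => ?_
    have : g u y = 0 := by
      by_contra h0
      exact (hg u y h0).2 hu
    rw [this, zero_add]
  have hsingle : ∀ v ∈ Z, ∀ u, B.Adj v u → ∑ y, h y u = h v u := by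
    intro v hv u hvu
    refine Finset.sum_eq_single v (fun y _ hy => ?_) (by simp)
    by_contra h0
    exact hy (huniq v hv y (hsupp y u h0).1 u hvu (hsupp y u h0).2)
  refine ⟨fun x y => g x y + g y x, fun x y => add_comm _ _, fun x y => ?_, fun x y hxy => ?_,
    fun x hxI hxZ => ?_, fun x hx => ?_, fun v hv u hvu => ?_⟩
  · have h1 := hgrange x y
    have h2 := hgrange y x
    by_cases h0 : g x y = 0
    · dsimp only; omega
    · have h3 := hg x y h0
      have : g y x = 0 := by
        by_contra h4
        exact (hg y x h4).2 ((hbip y x h3.1.symm).2 h3.2)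
      dsimp only; omega
  · by_cases h0 : g x y = 0
    · exact (hg y x fun h1 => hxy (by simp [h0, h1])).1.symm
    · exact (hg x y h0).1
  · rw [hsumR x hxI]
    have hh0 : ∀ y, h x y = 0 := fun y => by
      by_contra h0
      exact hxZ (hsupp x y h0).1
    simp [g, gW, hxI, hxZ, hh0]
  · rw [hsumI x hx]
    by_cases hv : ∃ v ∈ Z, B.Adj v x
    · obtain ⟨v, hv, hvx⟩ := hv
      rw [hsingle v hv x hvx]
      exact hnonneg v x
    · rw [Finset.sum_eq_zero fun y _ => ?_, add_zero]
      · exact he x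
      · by_contra h0
        exact hv ⟨y, hsupp y x h0⟩
  · have huI : u ∈ I := by
      by_contra hu
      exact hZI v hv ((hbip v u hvu).2 hu)
    rw [hsumR v (hZI v hv), hsumI u huI, hsingle v hv u hvu]
    have : ∑ y, g v y = ∑ y, h v y :=
      Finset.sum_congr rfl fun y _ => by simp [g, gW, hv]
    rw [this]
    exact hne v hv u hvu

theorem exists_weighting_of_bipartite {V : Type*} [Fintype V] (B : SimpleGraph V)
    (I Z : Set V) (hbip : ∀ x y, B.Adj x y → (x ∈ I ↔ y ∉ I)) (hZI : ∀ x ∈ Z, x ∉ I)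
    (hdom : ∀ x ∉ I, ∃ y, B.Adj x y) (hdeg : ∀ x ∈ Z, 2 ≤ B.degree x)
    (own : V → ℤ) (hown : ∀ x, own x = 0 ∨ own x = 1) :
    ∃ F : V → V → ℤ, (∀ x y, F x y = F y x) ∧ (∀ x y, -2 ≤ F x y ∧ F x y ≤ 1) ∧
      (∀ x y, F x y ≠ 0 → B.Adj x y) ∧
      (∀ x, x ∉ I → x ∉ Z → ∑ y, F x y = own x) ∧
      (∀ x ∈ I, 0 ≤ ∑ y, F x y) ∧
      ∀ x ∈ Z, ∀ u, B.Adj x u → ∑ y, F x y ≠ ∑ y, F u y := by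
  have hcomp : ∀ c : B.ConnectedComponent, ∃ F : V → V → ℤ, (∀ x y, F x y = F y x) ∧
      (∀ x y, -2 ≤ F x y ∧ F x y ≤ 1) ∧ (∀ x y, F x y ≠ 0 → B.Adj x y) ∧
      ∀ x, B.connectedComponentMk x = c → (x ∉ I → x ∉ Z → ∑ y, F x y = own x) ∧
        (x ∈ I → 0 ≤ ∑ y, F x y) ∧
        (x ∈ Z → ∀ u, B.Adj x u → ∑ y, F x y ≠ ∑ y, F u y) := by
    intro c
    by_cases hpair : ∃ v ∈ Z, ∃ v' ∈ Z, ∃ u, B.connectedComponentMk v = c ∧ v' ≠ v ∧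
        B.Adj v u ∧ B.Adj v' u
    · obtain ⟨v, hv, v', hv', u, rfl, hne, hvu, hv'u⟩ := hpair
      obtain ⟨F, h1, h2, h3, h4⟩ :=
        exists_weighting_of_common_neighbor B I Z hbip hZI own hown hv hv' hne hvu hv'u
      refine ⟨F, h1, h2, h3, fun x hx => ?_⟩
      have hvx : B.Reachable v x := (SimpleGraph.ConnectedComponent.exact hx).symm
      obtain ⟨hW, hI, hZ⟩ := h4 x hvx
      refine ⟨hW, fun hxI => (hI hxI).1, fun hxZ y hxy heq => ?_⟩
      have hyI : y ∈ I := by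
        by_contra hy
        exact hZI x hxZ ((hbip x y hxy).2 hy)
      obtain ⟨hpos, heven⟩ := (h4 y (hvx.trans hxy.reachable)).2.1 hyI
      rcases hZ hxZ with h | h
      · omega
      · exact Int.not_even_iff_odd.2 h (heq ▸ heven)
    · obtain ⟨F, h1, h2, h3, h4, h5, h6⟩ := exists_weighting_of_no_common_neighbor B I
        {x ∈ Z | B.connectedComponentMk x = c} hbip (fun x hx => hZI x hx.1) hdom
        (fun x hx => hdeg x hx.1) own hown (fun v hv v' hv' u hvu hv'u => by
          by_contra hne
          exact hpair ⟨v, hv.1, v', hv'.1, u, hv.2, hne, hvu, hv'u⟩)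
      exact ⟨F, h1, h2, h3, fun x hx => ⟨fun hxI hxZ => h4 x hxI fun h => hxZ h.1, h5 x,
        fun hxZ => h6 x ⟨hxZ, hx⟩⟩⟩
  choose F hsymm hrange hadj hF using hcomp
  refine ⟨fun x y => F (B.connectedComponentMk x) x y, fun x y => ?_, fun x y => hrange _ x y,
    fun x y => hadj _ x y, fun x => (hF _ x rfl).1, fun x => (hF _ x rfl).2.1,
    fun x hx u hxu => ?_⟩
  · by_cases hxy : B.Adj x y
    · dsimp only
      rw [SimpleGraph.ConnectedComponent.sound hxy.reachable, hsymm]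
    · have h1 : F (B.connectedComponentMk x) x y = 0 := by
        by_contra h
        exact hxy (hadj _ x y h)
      have h2 : F (B.connectedComponentMk y) y x = 0 := by
        by_contra h
        exact hxy (hadj _ y x h).symm
      simp only [h1, h2]
  · have := (hF _ x rfl).2.2 hx u hxu
    dsimp only
    rwa [← SimpleGraph.ConnectedComponent.sound hxu.reachable]

theorem exists_maximal_independent {V : Type*} [Fintype V] (G : SimpleGraph V) :
    ∃ I : Set V, (∀ x ∈ I, ∀ y ∈ I, ¬ G.Adj x y) ∧ ∀ x ∉ I, ∃ y ∈ I, G.Adj x y := by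
  obtain ⟨I, hI⟩ := (Set.toFinite {I : Set V | ∀ x ∈ I, ∀ y ∈ I, ¬ G.Adj x y}).exists_maximal
    ⟨∅, by simp⟩
  refine ⟨I, hI.prop, fun x hx => ?_⟩
  by_contra! hno
  refine hx (hI.le_of_ge (y := insert x I) ?_ (Set.subset_insert x I) (Set.mem_insert x I))
  rintro a (rfl | ha) b (rfl | hb)
  · exact G.irrefl
  · exact hno b hb
  · exact fun h => hno a ha h.symm
  · exact hI.prop a ha b hb

/-- Edge weights in `{-2, -1, 0, 1}` distinguishing adjacent vertices exist as soon as the minimum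
degree is at least two. -/
theorem exists_offset_weighting {V : Type*} [Fintype V] (G : SimpleGraph V)
    (hdeg : ∀ x, 2 ≤ G.degree x) :
    ∃ f : V → V → ℤ, (∀ x y, f x y = f y x) ∧ (∀ x y, -2 ≤ f x y ∧ f x y ≤ 1) ∧
      ∀ x y, G.Adj x y →
        ∑ z ∈ G.neighborFinset x, f x z ≠ ∑ z ∈ G.neighborFinset y, f y z := by
  obtain ⟨I, hindep, hmax⟩ := exists_maximal_independent G
  obtain ⟨Γ, hΓ⟩ : ∃ Γ : SimpleGraph V, ∀ x y, Γ.Adj x y ↔ G.Adj x y ∧ x ∉ I ∧ y ∉ I :=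
    ⟨{ Adj := fun x y => G.Adj x y ∧ x ∉ I ∧ y ∉ I
       symm := ⟨fun x y h => ⟨h.1.symm, h.2.2, h.2.1⟩⟩
       loopless := ⟨fun x h => G.irrefl h.1⟩ }, fun _ _ => Iff.rfl⟩
  obtain ⟨B, hB⟩ : ∃ B : SimpleGraph V, ∀ x y, B.Adj x y ↔ G.Adj x y ∧ (x ∈ I ↔ y ∉ I) :=
    ⟨{ Adj := fun x y => G.Adj x y ∧ (x ∈ I ↔ y ∉ I)
       symm := ⟨fun x y h => ⟨h.1.symm, by tauto⟩⟩
       loopless := ⟨fun x h => G.irrefl h.1⟩ }, fun _ _ => Iff.rfl⟩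
  let Z : Set V := {x | x ∉ I ∧ ∀ y, G.Adj x y → y ∈ I}
  obtain ⟨Y, own, c, hc, hYsymm, hYrange, -, hown, -, hproper, hneg, -⟩ :=
    exists_greedy_weighting Γ Finset.univ
  have hBZ : ∀ x ∈ Z, 2 ≤ B.degree x := by
    intro x hx
    have : B.neighborFinset x = G.neighborFinset x := by
      ext y
      simp only [SimpleGraph.mem_neighborFinset, hB]
      exact ⟨fun h => h.1, fun h => ⟨h, iff_of_false hx.1 (not_not.2 (hx.2 y h))⟩⟩
    rw [← SimpleGraph.card_neighborFinset_eq_degree, this,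
      SimpleGraph.card_neighborFinset_eq_degree]
    exact hdeg x
  obtain ⟨F, hFsymm, hFrange, hFadj, hFW, hFI, hFZ⟩ := exists_weighting_of_bipartite B I Z
    (fun x y h => ((hB x y).1 h).2) (fun x hx => hx.1)
    (fun x hx => by
      obtain ⟨y, hy, hxy⟩ := hmax x hx
      exact ⟨y, (hB x y).2 ⟨hxy, iff_of_false hx (not_not.2 hy)⟩⟩) hBZ own hown
  have hΓF : ∀ x y, Γ.Adj x y → F x y = 0 := by
    intro x y h
    rw [hΓ] at h
    by_contra h0
    exact h.2.1 (((hB x y).1 (hFadj x y h0)).2.2 h.2.2)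
  let f : V → V → ℤ := fun x y => F x y + if Γ.Adj x y then Y x y else 0
  have hsum : ∀ x, ∑ z ∈ G.neighborFinset x, f x z =
      ∑ z, F x z + ∑ z ∈ Γ.neighborFinset x, Y x z := by
    intro x
    simp only [f, Finset.sum_add_distrib]
    congr 1
    · refine Finset.sum_subset (Finset.subset_univ _) fun z _ hz => ?_
      by_contra h0
      exact hz (by simpa using ((hB x z).1 (hFadj x z h0)).1)
    · rw [← Finset.sum_filter]
      congr 1
      ext z
      simp only [Finset.mem_filter, SimpleGraph.mem_neighborFinset, hΓ]
      exact ⟨fun h => h.2, fun h => ⟨h.1, h⟩⟩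
  have hsumI : ∀ x ∈ I, ∑ z ∈ G.neighborFinset x, f x z = ∑ z, F x z := by
    intro x hx
    rw [hsum, Finset.sum_eq_zero (s := Γ.neighborFinset x) fun z hz => ?_, add_zero]
    rw [SimpleGraph.mem_neighborFinset, hΓ] at hz
    exact absurd hx hz.2.1
  have hsumZ : ∀ x ∈ Z, ∑ z ∈ G.neighborFinset x, f x z = ∑ z, F x z := by
    intro x hx
    rw [hsum, Finset.sum_eq_zero (s := Γ.neighborFinset x) fun z hz => ?_, add_zero]
    rw [SimpleGraph.mem_neighborFinset, hΓ] at hz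
    exact absurd (hx.2 z hz.1) hz.2.2
  have hsumW : ∀ x, x ∉ I → x ∉ Z → ∑ z ∈ G.neighborFinset x, f x z = c x := by
    intro x hxI hxZ
    rw [hsum, hFW x hxI hxZ, hc]
  have hIR : ∀ x ∈ I, ∀ y ∉ I, G.Adj x y →
      ∑ z ∈ G.neighborFinset x, f x z ≠ ∑ z ∈ G.neighborFinset y, f y z := by
    intro x hx y hy hxy
    by_cases hyZ : y ∈ Z
    · rw [hsumI x hx, hsumZ y hyZ]
      exact (hFZ y hyZ x ((hB y x).2 ⟨hxy.symm, iff_of_false hy (not_not.2 hx)⟩)).symm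
    · rw [hsumI x hx, hsumW y hy hyZ]
      have h1 := hFI x hx
      obtain ⟨z, hyz, hz⟩ : ∃ z, G.Adj y z ∧ z ∉ I := by
        by_contra! h
        exact hyZ ⟨hy, h⟩
      have h2 := hneg y (Finset.mem_univ _) z ((hΓ y z).2 ⟨hyz, hy, hz⟩)
      omega
  refine ⟨f, fun x y => ?_, fun x y => ?_, fun x y hxy => ?_⟩
  · simp only [f, hFsymm x y, hYsymm x y, Γ.adj_comm x y]
  · have h1 := hFrange x y
    have h2 := hYrange x y
    simp only [f]
    split_ifs with h
    · rw [hΓF x y h]; omega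
    · omega
  · by_cases hx : x ∈ I
    · exact hIR x hx y (fun hy => hindep x hx y hy hxy) hxy
    · by_cases hy : y ∈ I
      · exact (hIR y hy x hx hxy.symm).symm
      · rw [hsumW x hx fun h => hy (h.2 y hxy), hsumW y hy fun h => hx (h.2 x hxy.symm)]
        exact hproper x (Finset.mem_univ _) y (Finset.mem_univ _) ((hΓ x y).2 ⟨hxy, hx, hy⟩)

theorem stmt_7 {V : Type*} [Fintype V] (G : SimpleGraph V) (d : ℕ) (hd : 2 ≤ d)
    (hreg : G.IsRegularOfDegree d) :
    ∃ w : Sym2 V → ℕ,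
      (∀ e ∈ G.edgeSet, w e ∈ ({1, 2, 3, 4} : Set ℕ)) ∧
      ∀ u v : V, G.Adj u v →
        (∑ x ∈ G.neighborFinset u, w s(u, x)) ≠ (∑ x ∈ G.neighborFinset v, w s(v, x)) := by
  obtain ⟨f, hsymm, hrange, hf⟩ := exists_offset_weighting G fun x => (hreg x).symm ▸ hd
  let w : Sym2 V → ℕ := Sym2.lift ⟨fun x y => (3 + f x y).toNat, fun x y => by simp only [hsymm x y]⟩
  have hw : ∀ x y, (w s(x, y) : ℤ) = 3 + f x y := by
    intro x y
    have := hrange x y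
    simp only [w, Sym2.lift_mk]
    omega
  have hsum : ∀ u, ((∑ x ∈ G.neighborFinset u, w s(u, x) : ℕ) : ℤ) =
      d * 3 + ∑ x ∈ G.neighborFinset u, f u x := by
    intro u
    push_cast
    simp only [hw, Finset.sum_add_distrib, Finset.sum_const,
      SimpleGraph.card_neighborFinset_eq_degree, hreg u, nsmul_eq_mul]
  refine ⟨w, fun e _ => ?_, fun u v huv heq => hf u v huv ?_⟩
  · induction e using Sym2.ind with
    | _ x y =>
      have h1 := hw x y
      have h2 := hrange x y
      simp only [Set.mem_insert_iff, Set.mem_singleton_iff]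
      omega
  · have h1 := hsum u
    rw [heq, hsum v] at h1
    exact (add_left_cancel h1).symm
end

section
/- Every d-regular graph with d ≥ 10^8 admits an edge weighting with weights in {1,2,3} such that adjacent vertices receive distinct weighted degrees. -/
open scoped Classical

/-- Events determined by disjoint sets of coordinates are independent under the uniform
distribution on functions. -/
theorem card_filter_and_mul_card_of_dependsOn {V C : Type*} [Fintype V] [Fintype C] {S : Set V}
    {P Q : (V → C) → Prop} (hP : DependsOn P S) (hQ : DependsOn Q Sᶜ) :
    (Finset.univ.filter fun f => P f ∧ Q f).card * Fintype.card (V → C) =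
      (Finset.univ.filter P).card * (Finset.univ.filter Q).card := by
  rw [← Finset.card_univ, ← Finset.card_product, ← Finset.card_product]
  let mix : (V → C) × (V → C) → (V → C) × (V → C) := fun p =>
    (S.piecewise p.1 p.2, S.piecewise p.2 p.1)
  have mix_mix : ∀ p, mix (mix p) = p := by
    rintro ⟨f, g⟩
    ext x <;> by_cases hx : x ∈ S <;> simp [mix, hx]
  have hP' : ∀ f g, P (S.piecewise f g) = P f := fun f g =>
    hP fun x hx => by simp [hx]
  have hQ' : ∀ f g, Q (S.piecewise f g) = Q g := fun f g =>
    hQ fun x hx => by simp [Set.piecewise_eq_of_notMem _ _ _ hx]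
  refine Finset.card_nbij' mix mix ?_ ?_ (fun p _ => mix_mix p) (fun p _ => mix_mix p)
  · rintro ⟨f, g⟩ h
    simpa [mix, hP', hQ'] using h
  · rintro ⟨f, g⟩ h
    simpa [mix, hP', hQ'] using h

/-- The symmetric Lovász local lemma for events in a uniform product space, each of which
depends on few coordinates. -/
theorem exists_forall_not_of_dependsOn {V C ι : Type*} [Fintype V] [Fintype C] [Nonempty C]
    [Fintype ι] (bad : ι → (V → C) → Prop) (S : ι → Set V) (hS : ∀ i, DependsOn (bad i) (S i))
    (p : ℝ) (D : ℕ) (hp0 : 0 ≤ p) (hp : p < 1 / 2) (hpD : 4 * p * D ≤ 1)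
    (hD : ∀ i, (Finset.univ.filter fun j => ¬ Disjoint (S j) (S i)).card ≤ D)
    (hbad : ∀ i, ((Finset.univ.filter (bad i)).card : ℝ) ≤ p * Fintype.card (V → C)) :
    ∃ f, ∀ i, ¬ bad i f := by
  let good : Finset ι → (V → C) → Prop := fun T f => ∀ j ∈ T, ¬ bad j f
  let N : ((V → C) → Prop) → ℝ := fun P => ((Finset.univ.filter P).card : ℝ)
  have Nmono : ∀ P Q : (V → C) → Prop, (∀ f, P f → Q f) → N P ≤ N Q := fun P Q h => by
    simp only [N]
    exact_mod_cast Finset.card_le_card (Finset.monotone_filter_right _ (fun f _ hf => h f hf))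
  have Nsplit : ∀ P Q : (V → C) → Prop,
      N P = N (fun f => Q f ∧ P f) + N (fun f => ¬ Q f ∧ P f) := fun P Q => by
    simp only [N]
    rw [← Finset.card_filter_add_card_filter_not (s := Finset.univ.filter P) (p := Q),
      Finset.filter_filter, Finset.filter_filter]
    push_cast
    simp only [and_comm]
  have cardpos : (0 : ℝ) < Fintype.card (V → C) := by
    exact_mod_cast Fintype.card_pos
  have key : ∀ (n : ℕ) (T : Finset ι), T.card = n → ∀ i,
      N (fun f => bad i f ∧ good T f) ≤ 2 * p * N (good T) := by
    intro n
    induction n using Nat.strong_induction_on with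
    | _ n ih =>
      intro T hT i
      let near := T.filter fun j => ¬ Disjoint (S j) (S i)
      let far := T.filter fun j => Disjoint (S j) (S i)
      have hfar : DependsOn (good far) (S i)ᶜ := by
        intro f g hfg
        have : ∀ j ∈ far, bad j f = bad j g := fun j hj =>
          hS j fun x hx => hfg x fun hxi =>
            Set.disjoint_left.1 (Finset.mem_filter.1 hj).2 hx hxi
        simp only [good, eq_iff_iff]
        refine forall₂_congr fun j hj => ?_
        rw [this j hj]
      have indep : N (fun f => bad i f ∧ good far f) ≤ p * N (good far) := by
        have h := card_filter_and_mul_card_of_dependsOn (hS i) hfar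
        have h' : N (fun f => bad i f ∧ good far f) * (Fintype.card (V → C) : ℝ) =
            N (bad i) * N (good far) := by
          simp only [N]
          norm_cast
          convert h
        have h2 : N (bad i) * N (good far) ≤ p * Fintype.card (V → C) * N (good far) :=
          mul_le_mul_of_nonneg_right (hbad i) (by positivity)
        refine le_of_mul_le_mul_right ?_ cardpos
        linarith
      have hnonneg : 0 ≤ N (good far) := by positivity
      have sub : N (fun f => bad i f ∧ good T f) ≤ N (fun f => bad i f ∧ good far f) :=
        Nmono _ _ fun f hf => ⟨hf.1, fun j hj => hf.2 j (Finset.mem_filter.1 hj).1⟩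
      rcases near.eq_empty_or_nonempty with hne | hne
      · have : far = T := by
          apply Finset.filter_true_of_mem
          intro j hj
          by_contra hj'
          have : j ∈ near := Finset.mem_filter.2 ⟨hj, hj'⟩
          simp [hne] at this
        rw [this] at indep hnonneg
        nlinarith
      · have hlt : far.card < n := by
          have h1 : far.card + near.card = T.card :=
            Finset.card_filter_add_card_filter_not (s := T) (p := fun j => Disjoint (S j) (S i))
          have := hne.card_pos
          omega
        have hloss : ∀ U : Finset ι, N (good far) ≤
            N (good (U ∪ far)) + U.card * (2 * p * N (good far)) := by
          intro U
          induction U using Finset.induction_on with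
          | empty => simp
          | insert j U hj ihU =>
            have h1 := Nsplit (good (U ∪ far)) (bad j)
            have h2 : N (fun f => bad j f ∧ good (U ∪ far) f) ≤
                N (fun f => bad j f ∧ good far f) :=
              Nmono _ _ fun f hf => ⟨hf.1, fun k hk => hf.2 k (Finset.mem_union_right _ hk)⟩
            have h3 : N (fun f => ¬ bad j f ∧ good (U ∪ far) f) ≤
                N (good (insert j U ∪ far)) := Nmono _ _ fun f hf k hk => by
              rw [Finset.insert_union, Finset.mem_insert] at hk
              rcases hk with rfl | hk
              · exact hf.1
              · exact hf.2 k hk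
            have h4 := ih _ hlt far rfl j
            rw [Finset.card_insert_of_notMem hj]
            push_cast
            linarith
        have h1 := hloss near
        have hTeq : near ∪ far = T := by
          rw [Finset.union_comm]
          exact Finset.filter_union_filter_not_eq _ _
        rw [hTeq] at h1
        have hnear : (near.card : ℝ) ≤ D := by
          refine Nat.cast_le.2 (le_trans (Finset.card_le_card ?_) (hD i))
          exact Finset.filter_subset_filter _ (Finset.subset_univ T)
        have h2 : (near.card : ℝ) * (2 * p * N (good far)) ≤ N (good far) / 2 := by
          have h3 : (near.card : ℝ) * (2 * p) ≤ 1 / 2 := by nlinarith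
          nlinarith
        nlinarith
  have pos : ∀ T : Finset ι, 0 < N (good T) := by
    intro T
    induction T using Finset.induction_on with
    | empty => simpa [N, good] using cardpos
    | insert j T hj ihT =>
      have h1 := Nsplit (good T) (bad j)
      have h2 := key _ T rfl j
      have h3 : N (fun f => ¬ bad j f ∧ good T f) ≤ N (good (insert j T)) :=
        Nmono _ _ fun f hf k hk => by
          rcases Finset.mem_insert.1 hk with rfl | hk
          · exact hf.1
          · exact hf.2 k hk
      nlinarith
  have h := pos Finset.univ
  simp only [N, Nat.cast_pos, Finset.card_pos] at h
  obtain ⟨f, hf⟩ := h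
  exact ⟨f, by simpa [good] using hf⟩

theorem exp_le_one_add_add_sq {x : ℝ} (hx : |x| ≤ 1 / 5) :
    Real.exp x ≤ 1 + x + 11 / 20 * x ^ 2 := by
  have h := Real.exp_bound (x := x) (by linarith) (n := 3) (by norm_num)
  have h1 := (abs_le.1 h).2
  norm_num [Finset.sum_range_succ, Nat.factorial] at h1
  have h2 : |x| ^ 3 ≤ 1 / 5 * x ^ 2 := by
    rw [← sq_abs x]
    nlinarith [sq_nonneg |x|]
  nlinarith [sq_nonneg x]

/-- A Chernoff bound for the sum over `A` of a centred function of independent uniform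
colours. -/
theorem card_filter_le_sum_le_exp {V C : Type*} [Fintype V] [Fintype C] (A : Finset V)
    (ψ : C → ℝ) {s τ : ℝ} (hmean : ∑ c, ψ c = 0) (hψ : ∀ c, |ψ c| ≤ 2)
    (hvar : ∑ c, ψ c ^ 2 ≤ s * Fintype.card C) (hs : 0 < s) (hτ : 0 ≤ τ)
    (hτs : 10 * τ ≤ 11 / 10 * s) :
    ((Finset.univ.filter fun f : V → C => τ * A.card ≤ ∑ u ∈ A, ψ (f u)).card : ℝ) ≤
      Real.exp (-(A.card * (τ ^ 2 / (11 / 5 * s)))) * Fintype.card (V → C) := by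
  obtain ⟨r, hr⟩ : ∃ r, r = τ / (11 / 10 * s) := ⟨_, rfl⟩
  have hrs : r * (11 / 10 * s) = τ := by rw [hr]; field_simp
  have hr0 : 0 ≤ r := by rw [hr]; positivity
  have hr1 : r ≤ 1 / 10 := by rw [hr, div_le_iff₀ (by positivity)]; linarith
  have factor : ∑ c, Real.exp (r * ψ c) ≤
      Fintype.card C * Real.exp (11 / 20 * r ^ 2 * s) := by
    calc ∑ c, Real.exp (r * ψ c) ≤ ∑ c, (1 + r * ψ c + 11 / 20 * (r * ψ c) ^ 2) := by
          refine Finset.sum_le_sum fun c _ => exp_le_one_add_add_sq ?_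
          rw [abs_mul, abs_of_nonneg hr0]
          nlinarith [hψ c, abs_nonneg (ψ c)]
      _ = Fintype.card C + 11 / 20 * r ^ 2 * ∑ c, ψ c ^ 2 := by
          simp only [Finset.sum_add_distrib, ← Finset.mul_sum, hmean, mul_pow]
          simp
          ring
      _ ≤ Fintype.card C * (11 / 20 * r ^ 2 * s + 1) := by
          have : 11 / 20 * r ^ 2 * ∑ c, ψ c ^ 2 ≤ 11 / 20 * r ^ 2 * (s * Fintype.card C) := by
            gcongr
          linarith
      _ ≤ _ := by
          gcongr
          exact Real.add_one_le_exp _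
  have moment : ∑ f : V → C, Real.exp (r * ∑ u ∈ A, ψ (f u)) ≤
      Fintype.card (V → C) * Real.exp (A.card * (11 / 20 * r ^ 2 * s)) := by
    have h1 : ∀ f : V → C, Real.exp (r * ∑ u ∈ A, ψ (f u)) =
        ∏ u, if u ∈ A then Real.exp (r * ψ (f u)) else 1 := fun f => by
      rw [Finset.mul_sum, Real.exp_sum, Fintype.prod_ite_mem]
    simp only [h1]
    have h2 := Finset.prod_univ_sum (fun _ : V => (Finset.univ : Finset C))
      (fun u c => if u ∈ A then Real.exp (r * ψ c) else 1)
    rw [Fintype.piFinset_univ] at h2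
    rw [← h2]
    calc _ ≤ ∏ u : V, ((Fintype.card C : ℝ) *
          if u ∈ A then Real.exp (11 / 20 * r ^ 2 * s) else 1) := by
          refine Finset.prod_le_prod (fun u _ => Finset.sum_nonneg fun c _ => ?_) fun u _ => ?_
          · split_ifs <;> positivity
          · split_ifs
            · exact factor
            · simp
      _ = _ := by
          rw [Finset.prod_mul_distrib, Fintype.prod_ite_mem]
          simp [Real.exp_nat_mul]
  have markov : ((Finset.univ.filter fun f : V → C => τ * A.card ≤ ∑ u ∈ A, ψ (f u)).card : ℝ) *
      Real.exp (r * (τ * A.card)) ≤ ∑ f : V → C, Real.exp (r * ∑ u ∈ A, ψ (f u)) := by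
    rw [← nsmul_eq_mul]
    refine le_trans (Finset.card_nsmul_le_sum _ (fun f => Real.exp (r * ∑ u ∈ A, ψ (f u))) _
      fun f hf => ?_) (Finset.sum_le_univ_sum_of_nonneg fun f => (Real.exp_pos _).le)
    rw [Finset.mem_filter] at hf
    exact Real.exp_le_exp.2 (mul_le_mul_of_nonneg_left hf.2 hr0)
  have hexp : Real.exp (A.card * (11 / 20 * r ^ 2 * s)) =
      Real.exp (-(A.card * (τ ^ 2 / (11 / 5 * s)))) * Real.exp (r * (τ * A.card)) := by
    rw [← Real.exp_add]
    congr 1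
    rw [← hrs]
    field_simp
    ring
  refine le_of_mul_le_mul_right (markov.trans (moment.trans_eq ?_))
    (Real.exp_pos (r * (τ * A.card)))
  rw [hexp]
  ring

theorem sq_mul_exp_neg_le {d : ℝ} (hd : 10 ^ 8 ≤ d) :
    464 * Real.exp (-(d / 2200000)) * (d * d) ≤ 1 := by
  obtain ⟨x, rfl⟩ : ∃ x, d = 2200000 * x := ⟨d / 2200000, by ring⟩
  have hx : 45 ≤ x := by linarith
  have h45 : (10 : ℝ) ^ 19 ≤ Real.exp 45 := by
    have h : Real.exp 45 = Real.exp 1 ^ 45 := by rw [← Real.exp_nat_mul]; norm_num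
    rw [h]
    calc (10 : ℝ) ^ 19 ≤ 2.7 ^ 45 := by norm_num
      _ ≤ _ := by
        gcongr
        linarith [Real.exp_one_gt_d9]
  have hsq : x ^ 2 ≤ 45 ^ 2 * Real.exp (x - 45) := by
    have h1 : x ≤ 45 * Real.exp ((x - 45) / 2) := by
      have := Real.add_one_le_exp ((x - 45) / 2)
      linarith
    calc x ^ 2 ≤ (45 * Real.exp ((x - 45) / 2)) ^ 2 := by gcongr
      _ = 45 ^ 2 * Real.exp (x - 45) := by
        rw [mul_pow, ← Real.exp_nat_mul]
        congr 2
        push_cast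
        ring
  have hx' : Real.exp x = Real.exp 45 * Real.exp (x - 45) := by rw [← Real.exp_add]; ring_nf
  rw [mul_div_cancel_left₀ _ (by norm_num), Real.exp_neg, mul_assoc, mul_left_comm,
    inv_mul_le_one₀ (Real.exp_pos _), hx']
  have := mul_le_mul_of_nonneg_right h45 (Real.exp_pos (x - 45)).le
  nlinarith

/-- In a regular graph of large degree, vertices can be coloured so that the colours seen by every
vertex behave like the average with respect to a bounded number of test functions. -/
theorem exists_colouring_sum_neighbor_le {V C ι : Type*} [Fintype V] [Fintype C] [Nonempty C]
    [Fintype ι] (G : SimpleGraph V) (d : ℕ) (hd : 10 ^ 8 ≤ d) (hreg : G.IsRegularOfDegree d)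
    (hι : Fintype.card ι ≤ 116) (ψ : ι → C → ℝ) (s τ : ι → ℝ) (hmean : ∀ i, ∑ c, ψ i c = 0)
    (hψ : ∀ i c, |ψ i c| ≤ 2) (hvar : ∀ i, ∑ c, ψ i c ^ 2 ≤ s i * Fintype.card C)
    (hs : ∀ i, 0 < s i) (hτ : ∀ i, 0 ≤ τ i) (hτs : ∀ i, 10 * τ i ≤ 11 / 10 * s i)
    (hsτ : ∀ i, s i ≤ 10 ^ 6 * τ i ^ 2) :
    ∃ f : V → C, ∀ i v, ∑ u ∈ G.neighborFinset v, ψ i (f u) ≤ τ i * d := by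
  have hd' : (10 : ℝ) ^ 8 ≤ d := by exact_mod_cast hd
  have hnum := sq_mul_exp_neg_le hd'
  set q := Real.exp (-((d : ℝ) / 2200000)) with hq
  have hq0 : 0 < q := Real.exp_pos _
  have hq1 : 116 * q < 1 / 2 := by
    have : (1 : ℝ) ≤ d * d := by nlinarith
    nlinarith
  let bad : V → (V → C) → Prop := fun v f =>
    ∃ i, τ i * (G.neighborFinset v).card ≤ ∑ u ∈ G.neighborFinset v, ψ i (f u)
  have hdep : ∀ v, DependsOn (bad v) (G.neighborSet v) := by
    intro v f g hfg
    simp only [bad, eq_iff_iff]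
    refine exists_congr fun i => ?_
    rw [Finset.sum_congr rfl fun u hu => by
      rw [hfg u ((G.mem_neighborFinset v u).1 hu)]]
  have hcard : ∀ v, (Finset.univ.filter fun u =>
      ¬ Disjoint (G.neighborSet u) (G.neighborSet v)).card ≤ d * d := by
    intro v
    have hsub : (Finset.univ.filter fun u => ¬ Disjoint (G.neighborSet u) (G.neighborSet v)) ⊆
        (G.neighborFinset v).biUnion fun x => G.neighborFinset x := by
      intro u hu
      obtain ⟨x, hx1, hx2⟩ := Set.not_disjoint_iff.1 (Finset.mem_filter.1 hu).2
      exact Finset.mem_biUnion.2 ⟨x, (G.mem_neighborFinset v x).2 hx2,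
        (G.mem_neighborFinset x u).2 (G.adj_symm hx1)⟩
    refine (Finset.card_le_card hsub).trans (Finset.card_biUnion_le.trans ?_)
    simp [hreg.degree_eq]
  have hbad : ∀ v, ((Finset.univ.filter (bad v)).card : ℝ) ≤
      116 * q * Fintype.card (V → C) := by
    intro v
    have hsub : Finset.univ.filter (bad v) ⊆ Finset.univ.biUnion fun i =>
        Finset.univ.filter fun f : V → C =>
          τ i * (G.neighborFinset v).card ≤ ∑ u ∈ G.neighborFinset v, ψ i (f u) := by
      intro f hf
      obtain ⟨i, hi⟩ := (Finset.mem_filter.1 hf).2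
      exact Finset.mem_biUnion.2 ⟨i, Finset.mem_univ i, Finset.mem_filter.2 ⟨Finset.mem_univ f, hi⟩⟩
    have h1 : ((Finset.univ.filter (bad v)).card : ℝ) ≤ ∑ i, ((Finset.univ.filter fun f : V → C =>
          τ i * (G.neighborFinset v).card ≤ ∑ u ∈ G.neighborFinset v, ψ i (f u)).card : ℝ) := by
      exact_mod_cast (Finset.card_le_card hsub).trans Finset.card_biUnion_le
    refine h1.trans ((Finset.sum_le_card_nsmul _ _ (q * Fintype.card (V → C))
      fun i _ => ?_).trans ?_)
    · refine (card_filter_le_sum_le_exp (G.neighborFinset v) (ψ i) (hmean i) (hψ i) (hvar i)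
        (hs i) (hτ i) (hτs i)).trans ?_
      gcongr
      rw [hq, Real.exp_le_exp, neg_le_neg_iff, G.card_neighborFinset_eq_degree, hreg.degree_eq,
        div_eq_mul_one_div]
      refine mul_le_mul_of_nonneg_left ?_ (Nat.cast_nonneg d)
      rw [le_div_iff₀ (mul_pos (by norm_num) (hs i))]
      linarith [hsτ i]
    · rw [nsmul_eq_mul, Finset.card_univ, ← mul_assoc]
      have : (Fintype.card ι : ℝ) ≤ 116 := by exact_mod_cast hι
      gcongr
  have hpD : 4 * (116 * q) * ((d * d : ℕ) : ℝ) ≤ 1 := by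
    push_cast
    linarith
  obtain ⟨f, hf⟩ := exists_forall_not_of_dependsOn bad (fun v => G.neighborSet v) hdep (116 * q)
    (d * d) (by positivity) hq1 hpD hcard
    fun v => by convert hbad v
  refine ⟨f, fun i v => ?_⟩
  by_contra hlt
  refine hf v ⟨i, ?_⟩
  rw [G.card_neighborFinset_eq_degree, hreg.degree_eq]
  exact (not_le.1 hlt).le

/-- A partition of the vertices into classes of prescribed relative sizes `weight / 4000` such that
every neighbourhood sees the expected value of each integer test function `g j`, up to an error
of `e j / 4000` times the degree. -/
theorem exists_classes_abs_sum_neighbor_sub_le {V κ J : Type*} [Fintype V] [Fintype κ] [Fintype J]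
    (G : SimpleGraph V) (d : ℕ) (hd : 10 ^ 8 ≤ d) (hreg : G.IsRegularOfDegree d)
    (weight : κ → ℕ) (hweight : ∑ x, weight x = 4000) (hJ : Fintype.card J ≤ 58)
    (g : J → κ → ℤ) (e : J → ℕ) (hg : ∀ j x, |g j x| ≤ 1) (he : ∀ j, 1 ≤ e j)
    (hvar : ∀ j, ∑ x, weight x * g j x ^ 2 ≤ 250 * (e j : ℤ) ^ 2) :
    ∃ cls : V → κ, ∀ j v, |4000 * ∑ u ∈ G.neighborFinset v, g j (cls u) -
      d * ∑ x, weight x * g j x| ≤ e j * d := by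
  have hsum : ∀ F : κ → ℝ, ∑ c : (Σ x, Fin (weight x)), F c.1 = ∑ x, weight x * F x := fun F => by
    rw [Fintype.sum_sigma]
    simp
  have hcard : Fintype.card (Σ x, Fin (weight x)) = 4000 := by simpa using hweight
  have hne : Nonempty (Σ x, Fin (weight x)) := by
    rw [← Fintype.card_pos_iff, hcard]
    norm_num
  have hweight' : ∑ x, (weight x : ℝ) = 4000 := by exact_mod_cast hweight
  let M : J → ℤ := fun j => ∑ x, weight x * g j x
  have hM : ∀ j, ∑ x, (weight x : ℝ) * g j x = M j := fun j => by simp [M]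
  have hMle : ∀ j, |(M j : ℝ)| ≤ 4000 := fun j => by
    rw [← hM, ← hweight']
    refine (Finset.abs_sum_le_sum_abs _ _).trans (Finset.sum_le_sum fun x _ => ?_)
    have : |(g j x : ℝ)| ≤ 1 := by exact_mod_cast hg j x
    rw [abs_mul, Nat.abs_cast]
    exact mul_le_of_le_one_right (Nat.cast_nonneg _) this
  let sgn : Bool → ℝ := fun b => if b then 1 else -1
  have hsgn : ∀ b, |sgn b| = 1 := fun b => by cases b <;> simp [sgn]
  obtain ⟨f, hf⟩ := exists_colouring_sum_neighbor_le (ι := J × Bool)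
    (C := Σ x, Fin (weight x)) G d hd hreg
    (by rw [Fintype.card_prod, Fintype.card_bool]; omega)
    (fun i c => sgn i.2 * (g i.1 c.1 - M i.1 / 4000)) (fun i => (e i.1 : ℝ) ^ 2 / 16)
    (fun i => (e i.1 : ℝ) / 4000)
    (fun i => by
      rw [hsum fun x => sgn i.2 * (g i.1 x - M i.1 / 4000)]
      simp only [mul_left_comm _ (sgn i.2), ← Finset.mul_sum, mul_sub, Finset.sum_sub_distrib, hM,
        ← Finset.sum_mul, hweight']
      ring)
    (fun i c => by
      rw [abs_mul, hsgn, one_mul]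
      have h1 : |(g i.1 c.1 : ℝ)| ≤ 1 := by exact_mod_cast hg i.1 c.1
      have h2 : |(M i.1 : ℝ) / 4000| ≤ 1 := by
        rw [abs_div, div_le_one (by norm_num)]
        exact (hMle i.1).trans (le_abs_self _)
      exact (abs_sub _ _).trans (by linarith))
    (fun i => by
      rw [hsum fun x => (sgn i.2 * (g i.1 x - M i.1 / 4000)) ^ 2, hcard]
      have h1 : ∑ x, (weight x : ℝ) * (g i.1 x : ℝ) ^ 2 ≤ 250 * (e i.1 : ℝ) ^ 2 := by
        exact_mod_cast hvar i.1
      have h2 : ∑ x, (weight x : ℝ) * (sgn i.2 * (g i.1 x - M i.1 / 4000)) ^ 2 =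
          ∑ x, (weight x : ℝ) * (g i.1 x : ℝ) ^ 2 - (M i.1 : ℝ) ^ 2 / 4000 := by
        have h3 : ∀ x, (weight x : ℝ) * (sgn i.2 * (g i.1 x - M i.1 / 4000)) ^ 2 =
            (weight x : ℝ) * (g i.1 x : ℝ) ^ 2 - (M i.1 / 2000) * ((weight x : ℝ) * g i.1 x) +
              (M i.1 / 4000) ^ 2 * weight x := fun x => by
          rw [mul_pow, ← sq_abs (sgn _), hsgn]
          ring
        simp only [h3, Finset.sum_add_distrib, Finset.sum_sub_distrib, ← Finset.mul_sum, hM,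
          hweight']
        ring
      rw [h2]
      push_cast
      linarith [sq_nonneg (M i.1 : ℝ)])
    (fun i => by
      have : (0 : ℝ) < e i.1 := by exact_mod_cast he i.1
      positivity)
    (fun i => by positivity)
    (fun i => by
      have : (1 : ℝ) ≤ e i.1 := by exact_mod_cast he i.1
      nlinarith)
    (fun i => by
      rw [div_pow]
      linarith [sq_nonneg (e i.1 : ℝ)])
  refine ⟨fun v => (f v).1, fun j v => ?_⟩
  have h1 := hf (j, true) v
  have h2 := hf (j, false) v
  simp only [sgn, ← Finset.mul_sum, Finset.sum_sub_distrib, Finset.sum_const,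
    G.card_neighborFinset_eq_degree, hreg.degree_eq, nsmul_eq_mul, if_true, Bool.false_eq_true,
    if_false] at h1 h2
  have h3 : |4000 * ∑ u ∈ G.neighborFinset v, (g j (f u).1 : ℝ) - d * M j| ≤ e j * d := by
    rw [abs_le]
    constructor <;> linarith
  exact_mod_cast h3

/-- Greedy list colouring. -/
theorem exists_listColouring {V α : Type*} [Fintype V] (H : SimpleGraph V) (L : V → Finset α)
    (hL : ∀ v, (H.neighborFinset v).card < (L v).card) :
    ∃ f : V → α, (∀ v, f v ∈ L v) ∧ ∀ u v, H.Adj u v → f u ≠ f v := by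
  have hne : ∀ v, (L v).Nonempty := fun v => Finset.card_pos.1 (by have := hL v; omega)
  suffices h : ∀ S : Finset V, ∃ f : V → α, (∀ v, f v ∈ L v) ∧
      ∀ u ∈ S, ∀ v ∈ S, H.Adj u v → f u ≠ f v by
    obtain ⟨f, hf, hS⟩ := h Finset.univ
    exact ⟨f, hf, fun u v => hS u (Finset.mem_univ u) v (Finset.mem_univ v)⟩
  intro S
  induction S using Finset.induction_on with
  | empty => exact ⟨fun v => (hne v).choose, fun v => (hne v).choose_spec, by simp⟩
  | insert a S ha ih =>
    obtain ⟨f, hf, hS⟩ := ih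
    obtain ⟨x, hx, hx'⟩ : ∃ x ∈ L a, x ∉ (H.neighborFinset a).image f :=
      Finset.exists_mem_notMem_of_card_lt_card (Finset.card_image_le.trans_lt (hL a))
    have hne' : ∀ u, H.Adj a u → f u ≠ x := fun u hu h =>
      hx' (Finset.mem_image.2 ⟨u, (H.mem_neighborFinset a u).2 hu, h⟩)
    have hupd : ∀ u ∈ S, Function.update f a x u = f u := fun u hu =>
      Function.update_of_ne (by rintro rfl; exact ha hu) _ _
    refine ⟨Function.update f a x, fun v => ?_, ?_⟩
    · by_cases hv : v = a
      · subst hv; simpa using hx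
      · simpa [hv] using hf v
    · intro u hu v hv huv
      rw [Finset.mem_insert] at hu hv
      rcases hu with rfl | hu <;> rcases hv with rfl | hv
      · exact absurd huv (H.loopless.irrefl _)
      · rw [Function.update_self, hupd v hv]
        exact (hne' v huv).symm
      · rw [Function.update_self, hupd u hu]
        exact hne' u huv.symm
      · rw [hupd u hu, hupd v hv]
        exact hS u hu v hv huv

/-- A sum of signs over `P ∪ M`, nonnegative on `P` and nonpositive on `M`, can be any integer in
`[-#M, #P]`. -/
theorem exists_signs_sum_eq_s8 {V : Type*} (P M : Finset V) (hPM : Disjoint P M) (k : ℤ)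
    (hM : -(M.card : ℤ) ≤ k) (hP : k ≤ P.card) :
    ∃ y : V → ℤ, (∀ u, u ∉ P → u ∉ M → y u = 0) ∧ (∀ u ∈ P, y u = 0 ∨ y u = 1) ∧
      (∀ u ∈ M, y u = 0 ∨ y u = -1) ∧ ∑ u ∈ P ∪ M, y u = k := by
  rcases le_total 0 k with hk | hk
  · obtain ⟨T, hT, hTk⟩ := Finset.exists_subset_card_eq (s := P) (n := k.toNat) (by omega)
    refine ⟨fun u => if u ∈ T then 1 else 0, fun u hu _ => if_neg fun h => hu (hT h),
      fun u _ => (em (u ∈ T)).symm.imp (fun h => if_neg h) (fun h => if_pos h),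
      fun u hu => Or.inl (if_neg fun h => Finset.disjoint_left.1 hPM (hT h) hu), ?_⟩
    rw [Finset.sum_ite_mem, Finset.inter_eq_right.2 (hT.trans Finset.subset_union_left)]
    simp [hTk, hk]
  · obtain ⟨T, hT, hTk⟩ := Finset.exists_subset_card_eq (s := M) (n := (-k).toNat) (by omega)
    refine ⟨fun u => if u ∈ T then -1 else 0, fun u _ hu => if_neg fun h => hu (hT h),
      fun u hu => Or.inl (if_neg fun h => Finset.disjoint_left.1 hPM hu (hT h)),
      fun u _ => (em (u ∈ T)).symm.imp (fun h => if_neg h) (fun h => if_pos h), ?_⟩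
    rw [Finset.sum_ite_mem, Finset.inter_eq_right.2 (hT.trans Finset.subset_union_right)]
    simp [hTk, hk]

/-- Vertices `a ∈ A` one after the other change the edges to the set `T a` so as to make the values
`F a + ∑ u ∈ T a, z a u` of adjacent vertices of `A` distinct, while the accumulated change at
every other vertex stays in `{0, 1}`. -/
theorem exists_toggling {V : Type*} [Fintype V] (G : SimpleGraph V) (A : Finset V)
    (T : V → Finset V) (F : V → ℤ) (o : ℕ) (hT : ∀ a ∈ A, o ≤ (T a).card)
    (hA : ∀ a ∈ A, (A.filter fun b => G.Adj a b).card ≤ o) :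
    ∃ z : V → V → ℤ, (∀ a u, |z a u| ≤ 1) ∧ (∀ a u, z a u ≠ 0 → a ∈ A ∧ u ∈ T a) ∧
      (∀ u, ∑ a ∈ A, z a u = 0 ∨ ∑ a ∈ A, z a u = 1) ∧
      (∀ a ∈ A, |∑ u ∈ T a, z a u| ≤ o) ∧
      ∀ a ∈ A, ∀ b ∈ A, G.Adj a b → F a + ∑ u ∈ T a, z a u ≠ F b + ∑ u ∈ T b, z b u := by
  induction A using Finset.induction_on with
  | empty => exact ⟨fun _ _ => 0, by simp⟩
  | insert a A ha ih =>
    obtain ⟨z, hz1, hz0, hcol, hrow, hne⟩ := ih (fun b hb => hT b (Finset.mem_insert_of_mem hb))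
      fun b hb => (Finset.card_le_card (Finset.filter_subset_filter _
        (Finset.subset_insert a A))).trans (hA b (Finset.mem_insert_of_mem hb))
    let P := (T a).filter fun u => ∑ b ∈ A, z b u = 0
    let M := (T a).filter fun u => ¬ ∑ b ∈ A, z b u = 0
    have hPM : Disjoint P M := Finset.disjoint_filter_filter_not _ _ _
    have hun : P ∪ M = T a := Finset.filter_union_filter_not_eq _ _
    have hcard : (o : ℤ) ≤ P.card + M.card := by
      rw [← Nat.cast_add, ← Finset.card_union_of_disjoint hPM, hun]
      exact_mod_cast hT a (Finset.mem_insert_self a A)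
    let top : ℤ := min o P.card
    let taken := (A.filter fun b => G.Adj a b).image fun b => F b + ∑ u ∈ T b, z b u - F a
    obtain ⟨k, hk, hk'⟩ : ∃ k ∈ Finset.Icc (top - o) top, k ∉ taken := by
      refine Finset.exists_mem_notMem_of_card_lt_card (Finset.card_image_le.trans_lt ?_)
      have h := (Finset.card_le_card (Finset.filter_subset_filter _
        (Finset.subset_insert a A))).trans (hA a (Finset.mem_insert_self a A))
      rw [Int.card_Icc]
      omega
    rw [Finset.mem_Icc] at hk
    obtain ⟨y, hy0, hyP, hyM, hyk⟩ := exists_signs_sum_eq_s8 P M hPM k (by omega) (by omega)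
    rw [hun] at hyk
    have hk_ne : ∀ b ∈ A, G.Adj a b → F a + k ≠ F b + ∑ u ∈ T b, z b u := fun b hb hab h =>
      hk' (Finset.mem_image.2 ⟨b, Finset.mem_filter.2 ⟨hb, hab⟩, by omega⟩)
    have hyT : ∀ u, y u ≠ 0 → u ∈ T a := fun u hu => by
      by_contra h
      exact hu (hy0 u (fun h' => h (Finset.mem_filter.1 h').1)
        fun h' => h (Finset.mem_filter.1 h').1)
    have hupd : ∀ b ∈ A, Function.update z a y b = z b := fun b hb =>
      Function.update_of_ne (by rintro rfl; exact ha hb) _ _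
    refine ⟨Function.update z a y, fun b u => ?_, fun b u hu => ?_, fun u => ?_, fun b hb => ?_,
      fun b hb c hc hbc => ?_⟩
    · by_cases hb : b = a
      · subst hb
        rw [Function.update_self]
        by_cases hP : u ∈ P
        · rcases hyP u hP with h | h <;> simp [h]
        · by_cases hM : u ∈ M
          · rcases hyM u hM with h | h <;> simp [h]
          · simp [hy0 u hP hM]
      · rw [Function.update_of_ne hb]
        exact hz1 b u
    · by_cases hb : b = a
      · subst hb
        rw [Function.update_self] at hu
        exact ⟨Finset.mem_insert_self _ _, hyT u hu⟩
      · rw [Function.update_of_ne hb] at hu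
        exact (hz0 b u hu).imp_left (Finset.mem_insert_of_mem)
    · rw [Finset.sum_insert ha, Function.update_self,
        Finset.sum_congr rfl fun b hb => by rw [hupd b hb]]
      by_cases hu : u ∈ T a
      · by_cases hs : ∑ b ∈ A, z b u = 0
        · have := hyP u (Finset.mem_filter.2 ⟨hu, hs⟩)
          omega
        · have := hyM u (Finset.mem_filter.2 ⟨hu, hs⟩)
          have := hcol u
          omega
      · have : y u = 0 := by
          by_contra h
          exact hu (hyT u h)
        rw [this, zero_add]
        exact hcol u
    · rcases Finset.mem_insert.1 hb with rfl | hb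
      · rw [Function.update_self, hyk, abs_le]
        constructor <;> omega
      · rw [hupd b hb]
        exact hrow b hb
    · rw [Finset.mem_insert] at hb hc
      rcases hb with rfl | hb <;> rcases hc with rfl | hc
      · exact absurd hbc (G.loopless.irrefl _)
      · rw [Function.update_self, hyk, hupd c hc]
        exact hk_ne c hc hbc
      · rw [Function.update_self, hyk, hupd b hb]
        exact (hk_ne b hb hbc.symm).symm
      · rw [hupd b hb, hupd c hc]
        exact hne b hb c hc hbc

/-- The relative sizes of the 29 vertex classes, in units of `1 / 4000`. The first 9 classes are
called *delicate* and the last 6 are called *absorbing*. -/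
def classWeight : Fin 29 → ℕ :=
  ![97, 96, 97, 97, 86, 95, 69, 96, 77, 196, 196, 182, 128, 186, 196, 195, 196, 196, 196, 144, 196,
    196, 187, 100, 100, 100, 100, 100, 100]

/-- The absorbing class towards which the vertices of a non-absorbing class adjust their edges. -/
def targetClass : Fin 29 → Fin 29 :=
  ![23, 24, 25, 26, 27, 28, 23, 24, 25, 28, 27, 26, 25, 24, 23, 28, 27, 26, 25, 24, 23, 28, 27,
    0, 0, 0, 0, 0, 0]

/-- The rows of `baseWeight`, shifted by one and read as numbers in base 3. -/
def baseCode : Fin 29 → ℕ :=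
  ![34268117093028, 34269279354741, 34331008352409, 34272766154259, 34310350710189, 34301191343349,
    34310089603449, 34274187755262, 34300680211611, 45661899468816, 60718864812165, 65964582252432,
    67690196914590, 65727627708249, 68504237724411, 45718254719046, 60155786584872, 65229291038817,
    67781861304201, 68271838796190, 68529243200013, 45752290438554, 61002431922141, 68344456074043,
    45658277806414, 68629817216227, 66088380615079, 68598953189662, 68337473096767]

/-- The initial weight of the edges between two classes. -/
def baseWeight (c b : Fin 29) : ℤ := (baseCode c / 3 ^ (b : ℕ) % 3 : ℕ) - 1

/-- The expected initial weighted degree of a vertex, in units of `d / 4000`. -/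
def drift (c : Fin 29) : ℤ := ∑ b, classWeight b * baseWeight c b

/-- The maximal change that vertices of a class make to their own weighted degree, in units
of `d / 4000`. -/
def reach (c : Fin 29) : ℕ :=
  if c < 9 then classWeight c + 2 else if c < 23 then (classWeight c + 3) / 2 else 607

/-- The classes that adjust their edges towards `c`. -/
def sources (c : Fin 29) : Finset (Fin 29) :=
  Finset.univ.filter fun k => k < 23 ∧ targetClass k = c

/-- The maximal distance of the final weighted degree from `drift`, in units of `d / 4000`. -/
def window (c : Fin 29) : ℕ := reach c + 4 + ∑ k ∈ sources c, (classWeight k + 1)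

theorem sum_classWeight : ∑ c, classWeight c = 4000 := by decide

theorem baseWeight_symm : ∀ c b, baseWeight c b = baseWeight b c := by decide +kernel

theorem abs_baseWeight_le : ∀ c b, |baseWeight c b| ≤ 1 := by decide +kernel

theorem sum_classWeight_mul_sq_le (c : Fin 29) :
    ∑ b, classWeight b * baseWeight c b ^ 2 ≤ 250 * 4 ^ 2 := by
  revert c
  decide +kernel

theorem classWeight_le : ∀ c, classWeight c ≤ 250 := by decide

theorem le_targetClass : ∀ c < 23, 23 ≤ targetClass c := by decide

theorem baseWeight_targetClass : ∀ c < 23, baseWeight c (targetClass c) = 0 := by decide +kernel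

theorem baseWeight_delicate_absorbing : ∀ c < 9, ∀ a, 23 ≤ a → baseWeight c a = 0 := by
  decide +kernel

theorem reach_lt_classWeight_targetClass : ∀ c < 23, reach c + 1 ≤ classWeight (targetClass c) := by
  decide +kernel

theorem reach_delicate : ∀ c < 9, reach c = classWeight c + 2 := by decide

theorem le_two_mul_reach : ∀ c, 9 ≤ c → c < 23 → classWeight c + 2 ≤ 2 * reach c := by decide

theorem reach_absorbing : ∀ c, 23 ≤ c → reach c = 607 := by decide

theorem sum_absorbing_classWeight :
    ∑ c ∈ Finset.univ.filter (fun c : Fin 29 => 23 ≤ c), (classWeight c + 1) = 606 := by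
  decide +kernel

/-- The delicate classes whose edges to the absorbing class `a` are free. -/
def togglable (a : Fin 29) : Finset (Fin 29) :=
  Finset.univ.filter fun c => c < 9 ∧ targetClass c ≠ a

theorem le_sum_togglable : ∀ a, 23 ≤ a →
    607 ≤ ∑ c ∈ togglable a, ((classWeight c : ℤ) - 1) := by decide +kernel

theorem sources_eq_empty : ∀ c < 23, sources c = ∅ := by decide +kernel

theorem window_add_window_lt : ∀ c b, c ≠ b → c < 23 →
    (window c + window b + 1 : ℤ) ≤ |drift c - drift b| := by decide +kernel

theorem card_filter_mem_eq_sum {V κ : Type*} [DecidableEq κ] (s : Finset V) (f : V → κ)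
    (S : Finset κ) :
    (s.filter fun u => f u ∈ S).card = ∑ c ∈ S, (s.filter fun u => f u = c).card := by
  rw [Finset.card_eq_sum_card_fiberwise (f := f) (t := S) fun u hu => by
    simpa using (Finset.mem_filter.1 hu).2]
  refine Finset.sum_congr rfl fun c hc => congrArg _ ?_
  ext u
  simp only [Finset.mem_filter]
  exact ⟨fun h => ⟨h.1.1, h.2⟩, fun h => ⟨⟨h.1, h.2 ▸ hc⟩, h.2⟩⟩

/-- A partition of the vertices such that neighbourhoods see almost the expected proportions of the
classes and almost the expected sums of initial weights. -/
theorem exists_classes {V : Type*} [Fintype V] (G : SimpleGraph V) (d : ℕ) (hd : 10 ^ 8 ≤ d)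
    (hreg : G.IsRegularOfDegree d) :
    ∃ cls : V → Fin 29,
      (∀ v c, |4000 * (((G.neighborFinset v).filter fun u => cls u = c).card : ℤ) -
        d * classWeight c| ≤ d) ∧
      ∀ v, |4000 * ∑ u ∈ G.neighborFinset v, baseWeight (cls v) (cls u) - d * drift (cls v)| ≤
        4 * d := by
  obtain ⟨cls, h⟩ := exists_classes_abs_sum_neighbor_sub_le (κ := Fin 29) (J := Fin 29 ⊕ Fin 29)
    G d hd hreg classWeight sum_classWeight (by simp)
    (Sum.elim (fun c x => if x = c then 1 else 0) baseWeight) (Sum.elim (fun _ => 1) fun _ => 4)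
    (by
      rintro (c | c) x
      · simp only [Sum.elim_inl]
        split_ifs <;> simp
      · exact abs_baseWeight_le c x)
    (by rintro (c | c) <;> simp)
    (by
      rintro (c | c)
      · simpa using by exact_mod_cast classWeight_le c
      · simpa using sum_classWeight_mul_sq_le c)
  refine ⟨cls, fun v c => ?_, fun v => ?_⟩
  · simpa [Finset.sum_boole] using h (Sum.inl c) v
  · simpa [drift] using h (Sum.inr (cls v)) v

/-- The weight adjustments made by the non-absorbing vertices on their edges to absorbing ones. -/
theorem exists_target_adjustment {V : Type*} [Fintype V] (G : SimpleGraph V) (d : ℕ)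
    (hd : 10 ^ 8 ≤ d) (cls : V → Fin 29) (row : V → ℤ)
    (hcls : ∀ v c, |4000 * (((G.neighborFinset v).filter fun u => cls u = c).card : ℤ) -
        d * classWeight c| ≤ d) :
    ∃ y : V → V → ℤ, (∀ v u, |y v u| ≤ 1) ∧
      (∀ v u, y v u ≠ 0 → cls v < 23 ∧ cls u = targetClass (cls v)) ∧
      (∀ v, cls v < 23 → |4000 * ∑ u ∈ G.neighborFinset v, y v u| ≤ reach (cls v) * d) ∧
      (∀ v, cls v < 9 → Even (row v + ∑ u ∈ G.neighborFinset v, y v u)) ∧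
      ∀ u v, G.Adj u v → cls u = cls v → cls u < 23 →
        row u + ∑ x ∈ G.neighborFinset u, y u x ≠ row v + ∑ x ∈ G.neighborFinset v, y v x := by
  let o : Fin 29 → ℕ := fun c => reach c * d / 4000
  have ho : ∀ c, 4000 * o c ≤ reach c * d ∧ reach c * d < 4000 * o c + 4000 := fun c => by
    simp only [o]
    omega
  obtain ⟨H, hHadj⟩ : ∃ H : SimpleGraph V,
      ∀ u v, H.Adj u v ↔ G.Adj u v ∧ cls u = cls v ∧ cls u < 23 :=
    ⟨⟨fun u v => G.Adj u v ∧ cls u = cls v ∧ cls u < 23,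
      ⟨fun u v h => ⟨h.1.symm, h.2.1.symm, h.2.1 ▸ h.2.2⟩⟩, ⟨fun v h => G.loopless.irrefl v h.1⟩⟩,
      fun _ _ => Iff.rfl⟩
  have hH : ∀ v, cls v < 23 → 4000 * ((H.neighborFinset v).card : ℤ) ≤
      (classWeight (cls v) + 1) * d := fun v hv => by
    have hle : (H.neighborFinset v).card ≤
        ((G.neighborFinset v).filter fun u => cls u = cls v).card :=
      Finset.card_le_card fun u hu => by
        have hu' := (hHadj v u).1 ((H.mem_neighborFinset v u).1 hu)
        exact Finset.mem_filter.2 ⟨(G.mem_neighborFinset v u).2 hu'.1, hu'.2.1.symm⟩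
    have := (abs_le.1 (hcls v (cls v))).2
    zify at hle
    linarith
  have hH0 : ∀ v, ¬ cls v < 23 → (H.neighborFinset v).card = 0 := fun v hv =>
    Finset.card_eq_zero.2 (Finset.eq_empty_of_forall_notMem fun u hu =>
      hv ((hHadj v u).1 ((H.mem_neighborFinset v u).1 hu)).2.2)
  let low : V → ℤ := fun v => row v - o (cls v)
  obtain ⟨f, hf, hfne⟩ := exists_listColouring H
    (fun v => if cls v < 9
      then (Finset.range (o (cls v))).image fun k : ℕ => low v + low v % 2 + 2 * k
      else Finset.Icc (low v) (row v + o (cls v))) (fun v => by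
      have ho := ho (cls v)
      zify at ho
      split_ifs with h9
      · rw [Finset.card_image_of_injective _ (fun a b h => by simpa using h), Finset.card_range]
        have h := hH v (h9.trans (by decide))
        rw [reach_delicate _ h9] at ho
        zify
        push_cast at ho
        nlinarith
      · rw [Int.card_Icc]
        by_cases h23 : cls v < 23
        · have h := hH v h23
          have hr : (classWeight (cls v) + 2 : ℤ) ≤ 2 * reach (cls v) := by
            exact_mod_cast le_two_mul_reach _ (not_lt.1 h9) h23
          have : 4000 * ((H.neighborFinset v).card : ℤ) < 4000 * (2 * o (cls v) + 1) := by
            nlinarith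
          simp only [low]
          omega
        · rw [hH0 v h23]
          simp only [low]
          omega)
  have hf_near : ∀ v, |f v - row v| ≤ o (cls v) := fun v => by
    have h := hf v
    split_ifs at h with h9
    · obtain ⟨k, hk, hkf⟩ := Finset.mem_image.1 h
      have := Finset.mem_range.1 hk
      simp only [low] at hkf
      rw [abs_le]
      constructor <;> omega
    · rw [Finset.mem_Icc] at h
      simp only [low] at h
      rw [abs_le]
      constructor <;> omega
  have hf_even : ∀ v, cls v < 9 → Even (f v) := fun v h9 => by
    have h := hf v
    rw [if_pos h9] at h
    obtain ⟨k, -, hkf⟩ := Finset.mem_image.1 h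
    rw [Int.even_iff]
    omega
  have hy : ∀ v, ∃ y : V → ℤ, (∀ u, |y u| ≤ 1) ∧
      (∀ u, y u ≠ 0 → cls v < 23 ∧ cls u = targetClass (cls v)) ∧
      (cls v < 23 → ∑ u ∈ G.neighborFinset v, y u = f v - row v) := fun v => by
    by_cases h23 : cls v < 23
    · let S := (G.neighborFinset v).filter fun u => cls u = targetClass (cls v)
      have hS : (o (cls v) : ℤ) ≤ S.card := by
        have h1 := (abs_le.1 (hcls v (targetClass (cls v)))).1
        have h2 := reach_lt_classWeight_targetClass _ h23
        have h3 := (ho (cls v)).1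
        zify at h2 h3
        have : 4000 * (o (cls v) : ℤ) ≤ 4000 * S.card := by
          simp only [S]
          nlinarith
        omega
      have hk := abs_le.1 (hf_near v)
      obtain ⟨P, M, hPM, hU, hM, hP⟩ : ∃ P M : Finset V, Disjoint P M ∧ P ∪ M = S ∧
          -(M.card : ℤ) ≤ f v - row v ∧ f v - row v ≤ P.card := by
        rcases le_total 0 (f v - row v) with h | h
        · exact ⟨S, ∅, by simp, by simp, by simpa using h, by omega⟩
        · exact ⟨∅, S, by simp, by simp, by omega, by simpa using h⟩
      obtain ⟨y, hy0, hyP, hyM, hyk⟩ := exists_signs_sum_eq_s8 P M hPM (f v - row v) hM hP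
      have hyS : ∀ u, u ∉ S → y u = 0 := fun u hu => by
        rw [← hU, Finset.mem_union, not_or] at hu
        exact hy0 u hu.1 hu.2
      refine ⟨y, fun u => ?_, fun u hu => ⟨h23, ?_⟩, fun _ => ?_⟩
      · by_cases hu : u ∈ P
        · rcases hyP u hu with h | h <;> simp [h]
        · by_cases hu' : u ∈ M
          · rcases hyM u hu' with h | h <;> simp [h]
          · simp [hy0 u hu hu']
      · by_contra h
        exact hu (hyS u fun h' => h (Finset.mem_filter.1 h').2)
      · rw [← hyk, hU]
        exact (Finset.sum_subset (Finset.filter_subset _ _) fun u _ hu => hyS u hu).symm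
    · exact ⟨fun _ => 0, by simp, by simp, fun h => absurd h h23⟩
  choose y hy1 hy0 hysum using hy
  refine ⟨y, hy1, hy0, fun v hv => ?_, fun v hv => ?_, fun u v huv hc hu => ?_⟩
  · rw [hysum v hv, abs_mul]
    have h1 := (ho (cls v)).1
    have h2 := hf_near v
    zify at h1
    rw [abs_of_nonneg (by norm_num : (0 : ℤ) ≤ 4000)]
    linarith
  · rw [hysum v (hv.trans (by decide)), add_sub_cancel]
    exact hf_even v hv
  · rw [hysum u hu, hysum v (hc ▸ hu), add_sub_cancel, add_sub_cancel]
    exact hfne u v ((hHadj u v).2 ⟨huv, hc, hu⟩)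

/-- The weight adjustments made by the absorbing vertices on their edges to delicate ones. -/
theorem exists_absorbing_adjustment {V : Type*} [Fintype V] (G : SimpleGraph V) (d : ℕ)
    (cls : V → Fin 29) (F : V → ℤ)
    (hcls : ∀ v c, |4000 * (((G.neighborFinset v).filter fun u => cls u = c).card : ℤ) -
        d * classWeight c| ≤ d) :
    ∃ z : V → V → ℤ, (∀ a u, |z a u| ≤ 1) ∧
      (∀ a u, z a u ≠ 0 → 23 ≤ cls a ∧ cls u < 9 ∧ targetClass (cls u) ≠ cls a) ∧
      (∀ u, ∑ a ∈ G.neighborFinset u, z a u = 0 ∨ ∑ a ∈ G.neighborFinset u, z a u = 1) ∧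
      (∀ a, 23 ≤ cls a → |4000 * ∑ u ∈ G.neighborFinset a, z a u| ≤ reach (cls a) * d) ∧
      ∀ a b, 23 ≤ cls a → 23 ≤ cls b → G.Adj a b →
        F a + ∑ u ∈ G.neighborFinset a, z a u ≠ F b + ∑ u ∈ G.neighborFinset b, z b u := by
  let A : Finset V := Finset.univ.filter fun a => 23 ≤ cls a
  let T : V → Finset V := fun a => (G.neighborFinset a).filter fun u => cls u ∈ togglable (cls a)
  let o := 607 * d / 4000
  have hA : ∀ a, a ∈ A ↔ 23 ≤ cls a := fun a => by simp [A]
  have hTo : ∀ a ∈ A, o ≤ (T a).card := fun a ha => by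
    have h := mul_le_mul_of_nonneg_left (le_sum_togglable _ ((hA a).1 ha)) (Int.natCast_nonneg d)
    have : (d : ℤ) * ∑ c ∈ togglable (cls a), ((classWeight c : ℤ) - 1) ≤ 4000 * (T a).card := by
      simp only [T]
      rw [card_filter_mem_eq_sum, Nat.cast_sum, Finset.mul_sum, Finset.mul_sum]
      refine Finset.sum_le_sum fun c _ => ?_
      have := (abs_le.1 (hcls a c)).1
      linarith
    simp only [o]
    omega
  have hAo : ∀ a ∈ A, (A.filter fun b => G.Adj a b).card ≤ o := fun a _ => by
    have hle : (A.filter fun b => G.Adj a b).card ≤ ((G.neighborFinset a).filter fun u =>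
        cls u ∈ Finset.univ.filter (fun c : Fin 29 => 23 ≤ c)).card :=
      Finset.card_le_card fun b hb => by
        have hb' := Finset.mem_filter.1 hb
        simpa using ⟨hb'.2, (hA b).1 hb'.1⟩
    have : 4000 * (((G.neighborFinset a).filter fun u =>
        cls u ∈ Finset.univ.filter (fun c : Fin 29 => 23 ≤ c)).card : ℤ) ≤ d * (606 : ℕ) := by
      rw [← sum_absorbing_classWeight, card_filter_mem_eq_sum, Nat.cast_sum, Nat.cast_sum,
        Finset.mul_sum, Finset.mul_sum]
      refine Finset.sum_le_sum fun c _ => ?_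
      have := (abs_le.1 (hcls a c)).2
      push_cast
      linarith
    simp only [o]
    omega
  obtain ⟨z, hz1, hz0, hcol, hrow, hne⟩ := exists_toggling G A T F o hTo hAo
  have hT : ∀ a, ∑ u ∈ T a, z a u = ∑ u ∈ G.neighborFinset a, z a u := fun a =>
    Finset.sum_subset (Finset.filter_subset _ _) fun u _ hu => by
      by_contra h
      exact hu (hz0 a u h).2
  have hcol' : ∀ u, ∑ a ∈ A, z a u = ∑ a ∈ G.neighborFinset u, z a u := fun u => by
    rw [Finset.sum_subset (Finset.subset_univ A),
      Finset.sum_subset (Finset.subset_univ (G.neighborFinset u))]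
    · intro a _ ha
      by_contra h
      have := (Finset.mem_filter.1 (hz0 a u h).2).1
      exact ha ((G.mem_neighborFinset u a).2 ((G.mem_neighborFinset a u).1 this).symm)
    · intro a _ ha
      by_contra h
      exact ha (hz0 a u h).1
  refine ⟨z, hz1, fun a u h => ?_, fun u => hcol' u ▸ hcol u, fun a ha => ?_,
    fun a b ha hb hab => ?_⟩
  · obtain ⟨ha, hu⟩ := hz0 a u h
    have := (Finset.mem_filter.1 hu).2
    exact ⟨(hA a).1 ha, by simpa [togglable] using this⟩
  · have h := hrow a ((hA a).2 ha)
    rw [← hT, abs_mul, reach_absorbing _ ha, abs_of_nonneg (by norm_num : (0 : ℤ) ≤ 4000)]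
    simp only [o] at h
    omega
  · rw [← hT, ← hT]
    exact hne a ((hA a).2 ha) b ((hA b).2 hb) hab

/-- A symmetric weighting by `-1`, `0` and `1` that distinguishes adjacent vertices. -/
theorem exists_signed_weighting {V : Type*} [Fintype V] (G : SimpleGraph V) (d : ℕ)
    (hd : 10 ^ 8 ≤ d) (hreg : G.IsRegularOfDegree d) :
    ∃ x : V → V → ℤ, (∀ u v, x u v = x v u) ∧ (∀ u v, |x u v| ≤ 1) ∧
      ∀ u v, G.Adj u v →
        ∑ t ∈ G.neighborFinset u, x u t ≠ ∑ t ∈ G.neighborFinset v, x v t := by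
  obtain ⟨cls, hcls, hrow⟩ := exists_classes G d hd hreg
  let row : V → ℤ := fun v => ∑ u ∈ G.neighborFinset v, baseWeight (cls v) (cls u)
  obtain ⟨y, hy1, hy0, hyle, hyeven, hyne⟩ := exists_target_adjustment G d hd cls row hcls
  let base : V → ℤ := fun v => row v + ∑ u ∈ G.neighborFinset v, y u v
  obtain ⟨z, hz1, hz0, hzcol, hzle, hzne⟩ := exists_absorbing_adjustment G d cls base hcls
  have hy_source : ∀ v u, ¬ cls v < 23 → y v u = 0 := fun v u hv => by
    by_contra h
    exact hv (hy0 v u h).1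
  have hy_target : ∀ v u, cls u < 23 → y v u = 0 := fun v u hu => by
    by_contra h
    obtain ⟨h1, h2⟩ := hy0 v u h
    exact absurd hu (not_lt.2 (h2 ▸ le_targetClass _ h1))
  have hz_source : ∀ v u, cls v < 23 → z v u = 0 := fun v u hv => by
    by_contra h
    exact absurd hv (not_lt.2 (hz0 v u h).1)
  have hz_target : ∀ v u, ¬ cls u < 9 → z v u = 0 := fun v u hu => by
    by_contra h
    exact hu (hz0 v u h).2.1
  let x : V → V → ℤ := fun u v => baseWeight (cls u) (cls v) + y u v + y v u + z u v + z v u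
  have hx_symm : ∀ u v, x u v = x v u := fun u v => by
    simp only [x, baseWeight_symm (cls u)]
    ring
  have hx_of_y : ∀ u v, y u v ≠ 0 → |x u v| ≤ 1 := fun u v h => by
    obtain ⟨hu, hv⟩ := hy0 u v h
    have hzv : z v u = 0 := by
      by_contra h'
      exact (hz0 v u h').2.2 hv.symm
    simp only [x, hv, baseWeight_targetClass _ hu, hy_target v u hu, hz_source u v hu, hzv]
    simpa using hy1 u v
  have hx_of_z : ∀ u v, z u v ≠ 0 → |x u v| ≤ 1 := fun u v h => by
    obtain ⟨hu, hv, hne⟩ := hz0 u v h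
    have hv' : cls v < 23 := hv.trans (by decide)
    have hyv : y v u = 0 := by
      by_contra h'
      exact hne (hy0 v u h').2.symm
    simp only [x, baseWeight_symm (cls u), baseWeight_delicate_absorbing _ hv _ hu,
      hy_target u v hv', hz_source v u hv', hyv]
    simpa using hz1 u v
  have hx1 : ∀ u v, |x u v| ≤ 1 := fun u v => by
    by_cases h1 : y u v = 0
    · by_cases h2 : y v u = 0
      · by_cases h3 : z u v = 0
        · by_cases h4 : z v u = 0
          · simpa [x, h1, h2, h3, h4] using abs_baseWeight_le (cls u) (cls v)
          · exact hx_symm v u ▸ hx_of_z v u h4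
        · exact hx_of_z u v h3
      · exact hx_symm v u ▸ hx_of_y v u h2
    · exact hx_of_y u v h1
  let own : V → ℤ := fun v => ∑ u ∈ G.neighborFinset v, y v u
  let toggle : V → ℤ := fun v => ∑ u ∈ G.neighborFinset v, z u v
  have hsum : ∀ v, ∑ u ∈ G.neighborFinset v, x v u = row v + own v +
      ∑ u ∈ G.neighborFinset v, y u v + ∑ u ∈ G.neighborFinset v, z v u + toggle v := fun v => by
    simp only [x, Finset.sum_add_distrib, row, own, toggle]
  have hsum_low : ∀ v, cls v < 23 → ∑ u ∈ G.neighborFinset v, x v u = row v + own v + toggle v :=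
    fun v hv => by
      rw [hsum, Finset.sum_eq_zero fun u _ => hy_target u v hv,
        Finset.sum_eq_zero fun u _ => hz_source v u hv]
      ring
  have hsum_high : ∀ v, ¬ cls v < 23 →
      ∑ u ∈ G.neighborFinset v, x v u = base v + ∑ u ∈ G.neighborFinset v, z v u := fun v hv => by
    have h1 : own v = 0 := Finset.sum_eq_zero fun u _ => hy_source v u hv
    have h2 : toggle v = 0 := Finset.sum_eq_zero fun u _ =>
      hz_target u v fun h => hv (h.trans (by decide))
    rw [hsum, h1, h2]
    ring
  have hreceived : ∀ v, |4000 * ∑ u ∈ G.neighborFinset v, y u v| ≤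
      d * ∑ k ∈ sources (cls v), ((classWeight k : ℤ) + 1) := fun v => by
    have h1 : |∑ u ∈ G.neighborFinset v, y u v| ≤
        ((G.neighborFinset v).filter fun u => cls u ∈ sources (cls v)).card := by
      rw [Finset.card_filter, Nat.cast_sum]
      refine (Finset.abs_sum_le_sum_abs _ _).trans (Finset.sum_le_sum fun u _ => ?_)
      by_cases h : y u v = 0
      · rw [h, abs_zero]
        exact Int.natCast_nonneg _
      · obtain ⟨hu, hv⟩ := hy0 u v h
        rw [if_pos (by simp [sources, hu, hv])]
        exact hy1 u v
    rw [card_filter_mem_eq_sum, Nat.cast_sum] at h1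
    rw [abs_mul, abs_of_nonneg (by norm_num : (0 : ℤ) ≤ 4000)]
    refine (mul_le_mul_of_nonneg_left h1 (by norm_num)).trans ?_
    rw [Finset.mul_sum, Finset.mul_sum]
    refine Finset.sum_le_sum fun k _ => ?_
    have := (abs_le.1 (hcls v k)).2
    linarith
  have hwindow : ∀ v, |4000 * ∑ u ∈ G.neighborFinset v, x v u - d * drift (cls v)| ≤
      window (cls v) * d + 4000 := fun v => by
    have h1 := abs_le.1 (hrow v)
    have h2 := abs_le.1 (hreceived v)
    have hw : (window (cls v) : ℤ) =
        reach (cls v) + 4 + ∑ k ∈ sources (cls v), ((classWeight k : ℤ) + 1) := by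
      simp [window]
    have hr : row v = ∑ u ∈ G.neighborFinset v, baseWeight (cls v) (cls u) := rfl
    by_cases hv : cls v < 23
    · have h3 := abs_le.1 (hyle v hv)
      have h4 := hzcol v
      have h5 : own v = ∑ u ∈ G.neighborFinset v, y v u := rfl
      have h6 : 0 ≤ toggle v ∧ toggle v ≤ 1 := by
        simp only [toggle]
        omega
      rw [hsum_low v hv, hw, sources_eq_empty _ hv, Finset.sum_empty, hr, h5, abs_le]
      constructor <;> linarith
    · have h3 := abs_le.1 (hzle v (not_lt.1 hv))
      have hb : base v = row v + ∑ u ∈ G.neighborFinset v, y u v := rfl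
      rw [hsum_high v hv, hw, hb, hr, abs_le]
      constructor <;> linarith
  have hsep : ∀ u v, cls u ≠ cls v → cls u < 23 →
      ∑ t ∈ G.neighborFinset u, x u t ≠ ∑ t ∈ G.neighborFinset v, x v t := fun u v hc hu h => by
    have h1 := hwindow u
    have h2 := hwindow v
    have h3 := window_add_window_lt _ _ hc hu
    rw [h] at h1
    have h4 : (d : ℤ) * |drift (cls u) - drift (cls v)| ≤
        (window (cls u) + window (cls v)) * d + 8000 := by
      rw [← Nat.abs_cast d, ← abs_mul, Nat.abs_cast]
      rw [abs_le] at h1 h2 ⊢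
      constructor <;> linarith
    have h5 : (10 ^ 8 : ℤ) ≤ d := by exact_mod_cast hd
    nlinarith
  refine ⟨x, hx_symm, hx1, fun u v huv => ?_⟩
  by_cases hc : cls u = cls v
  · by_cases hu : cls u < 23
    · have hv : cls v < 23 := hc ▸ hu
      have hne : row u + own u ≠ row v + own v := hyne u v huv hc hu
      rw [hsum_low u hu, hsum_low v hv]
      by_cases hu9 : cls u < 9
      · have h1 : Even (row u + own u) := hyeven u hu9
        have h2 : Even (row v + own v) := hyeven v (hc ▸ hu9)
        have h3 : toggle u = 0 ∨ toggle u = 1 := hzcol u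
        have h4 : toggle v = 0 ∨ toggle v = 1 := hzcol v
        rw [Int.even_iff] at h1 h2
        omega
      · have h3 : toggle u = 0 := Finset.sum_eq_zero fun t _ => hz_target t u hu9
        have h4 : toggle v = 0 := Finset.sum_eq_zero fun t _ => hz_target t v (hc ▸ hu9)
        rwa [h3, h4, add_zero, add_zero]
    · have hv : ¬ cls v < 23 := hc ▸ hu
      rw [hsum_high u hu, hsum_high v hv]
      exact hzne u v (not_lt.1 hu) (not_lt.1 hv) huv
  · by_cases hu : cls u < 23
    · exact hsep u v hc hu
    · by_cases hv : cls v < 23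
      · exact (hsep v u (Ne.symm hc) hv).symm
      · rw [hsum_high u hu, hsum_high v hv]
        exact hzne u v (not_lt.1 hu) (not_lt.1 hv) huv

theorem stmt_8 {V : Type*} [Fintype V] (G : SimpleGraph V) (d : ℕ) (hd : 10 ^ 8 ≤ d)
    (hreg : G.IsRegularOfDegree d) :
    ∃ w : Sym2 V → ℕ,
      (∀ e ∈ G.edgeSet, w e ∈ ({1, 2, 3} : Set ℕ)) ∧
      ∀ u v : V, G.Adj u v →
        (∑ x ∈ G.neighborFinset u, w s(u, x)) ≠ (∑ x ∈ G.neighborFinset v, w s(v, x)) := by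
  obtain ⟨x, hsymm, hx, hne⟩ := exists_signed_weighting G d hd hreg
  let w : Sym2 V → ℕ := Sym2.lift ⟨fun u v => (x u v + 2).toNat,
    fun u v => by simp only [hsymm u v]⟩
  have hw : ∀ u v, w s(u, v) = (x u v + 2).toNat := fun _ _ => rfl
  have hsum : ∀ v, ((∑ u ∈ G.neighborFinset v, w s(v, u) : ℕ) : ℤ) =
      ∑ u ∈ G.neighborFinset v, x v u + 2 * d := fun v => by
    have hcard : (G.neighborFinset v).card = d := hreg.degree_eq v
    rw [Nat.cast_sum, Finset.sum_congr rfl (g := fun u => x v u + 2) fun u _ => by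
      have := abs_le.1 (hx v u)
      rw [hw]
      omega, Finset.sum_add_distrib, Finset.sum_const, hcard]
    simp [mul_comm]
  refine ⟨w, fun e _ => ?_, fun u v huv h => hne u v huv ?_⟩
  · induction e using Sym2.ind with
    | _ u v =>
      have := abs_le.1 (hx u v)
      rw [hw]
      simp only [Set.mem_insert_iff, Set.mem_singleton_iff]
      omega
  · have h' := congrArg (Nat.cast : ℕ → ℤ) h
    rw [hsum, hsum] at h'
    linarith
end
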